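/- arXiv:1608.02709 — 4 statements merged into one kernel-verified Lean document; each statement's English description precedes it below -/
import Mathlib

section
/- Let (F_1,…,F_m;k) be an instance of the hMaf problem and suppose Reduction Rule 1 is applicable on F_j relative to F_i with edge e removed from F_j, producing the instance (F_1,…,F_j∖{e},…,F_m;k'), where k' = k−1 if Ord(F_j) = Ord_max(F_1,…,F_m;k) and k' = k otherwise. Then the instances (F_1,…,F_m;k) and (F_1,…,F_j∖{e},…,F_m;k') have exactly the same collection of solutions. -/
/-!
A formalization framework for the Maximum Agreement Forest problem on multiple
rooted multifurcating phylogenetic trees.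

An `X`-forest is modeled (up to forced contraction and label-preserving
isomorphism) by the laminar family of the label-sets `L(v)` of its vertices:
every vertex `v` is identified with the set `L(v)` of labels at its leaf
descendants, components correspond to the maximal clusters, leaves to the
singleton clusters, and the edge between a non-root vertex `v` and its parent
is identified with the cluster `L(v)`.
-/

open Finset

noncomputable section
open scoped Classical

/-- A rooted multifurcating phylogenetic `X`-forest, described by the laminar
family of the label sets of its vertices. -/
structure XForest (X : Type*) where
  clusters : Finset (Finset X)
  nonempty_of_mem : ∀ s ∈ clusters, s.Nonempty
  laminar : ∀ s ∈ clusters, ∀ t ∈ clusters, ¬Disjoint s t → s ⊆ t ∨ t ⊆ s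
  singleton_mem : ∀ x : X, {x} ∈ clusters

namespace XForest

variable {X : Type*} [DecidableEq X] [Fintype X]

/-- The connected components of an `X`-forest: the maximal clusters.  The
component `C` is identified with its label set `L(C)`. -/
def components (F : XForest X) : Finset (Finset X) :=
  F.clusters.filter fun s => ∀ t ∈ F.clusters, ¬s ⊂ t

/-- The order of an `X`-forest: its number of connected components. -/
def ord (F : XForest X) : ℕ := F.components.card

/-- `c` is (the cluster of) a child of (the vertex with cluster) `p`. -/
def IsChild (F : XForest X) (c p : Finset X) : Prop :=
  c ∈ F.clusters ∧ p ∈ F.clusters ∧ c ⊂ p ∧ ∀ t ∈ F.clusters, c ⊂ t → ¬t ⊂ p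

/-- The family obtained from the laminar family `A` by removing, for every
`d ∈ D`, the edge between the vertex with cluster `d` and its parent. -/
def cutFam (A D : Finset (Finset X)) : Finset (Finset X) :=
  (A.image fun s => s \ (D.filter fun d => d ⊂ s).biUnion id).filter fun s => s.Nonempty

/-- The `X`-forest obtained from `F` by removing the edges above the clusters
in `D` (followed by forced contraction). -/
def cut (F : XForest X) (D : Finset (Finset X)) : XForest X where
  clusters := cutFam F.clusters (D.filter fun d => d ∈ F.clusters)
  nonempty_of_mem := fun s hs => (Finset.mem_filter.mp hs).2
  laminar := by
    intro s' hs' t' ht' hnd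
    set D' : Finset (Finset X) := D.filter fun d => d ∈ F.clusters with hD'def
    have hD'sub : ∀ d ∈ D', d ∈ F.clusters := fun d hd => (Finset.mem_filter.mp hd).2
    obtain ⟨hs'm, -⟩ := Finset.mem_filter.mp hs'
    obtain ⟨s, hs, rfl⟩ := Finset.mem_image.mp hs'm
    obtain ⟨ht'm, -⟩ := Finset.mem_filter.mp ht'
    obtain ⟨t, ht, rfl⟩ := Finset.mem_image.mp ht'm
    obtain ⟨x, hxs, hxt⟩ := Finset.not_disjoint_iff.mp hnd
    have key : ∀ u ∈ F.clusters, ∀ w ∈ F.clusters, u ⊆ w →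
        ∀ z, z ∈ u \ (D'.filter fun d => d ⊂ u).biUnion id →
          z ∈ w \ (D'.filter fun d => d ⊂ w).biUnion id →
          u \ (D'.filter fun d => d ⊂ u).biUnion id ⊆
            w \ (D'.filter fun d => d ⊂ w).biUnion id := by
      intro u hu w hw huw z hzu hzw y hy
      rw [Finset.mem_sdiff] at hy hzu hzw ⊢
      refine ⟨huw hy.1, ?_⟩
      intro hyU
      rw [Finset.mem_biUnion] at hyU
      obtain ⟨d, hd, hyd⟩ := hyU
      rw [Finset.mem_filter] at hd
      have hdF : d ∈ F.clusters := hD'sub d hd.1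
      have hdw : d ⊂ w := hd.2
      have hlam := F.laminar d hdF u hu (Finset.not_disjoint_iff.mpr ⟨y, hyd, hy.1⟩)
      rcases hlam with hdu | hud
      · by_cases hde : d = u
        · exact hzw.2 (Finset.mem_biUnion.mpr
            ⟨d, Finset.mem_filter.mpr ⟨hd.1, hdw⟩, hde ▸ hzu.1⟩)
        · have hss : d ⊂ u := Finset.ssubset_iff_subset_ne.mpr ⟨hdu, hde⟩
          exact hy.2 (Finset.mem_biUnion.mpr
            ⟨d, Finset.mem_filter.mpr ⟨hd.1, hss⟩, hyd⟩)
      · exact hzw.2 (Finset.mem_biUnion.mpr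
          ⟨d, Finset.mem_filter.mpr ⟨hd.1, hdw⟩, hud hzu.1⟩)
    have hxs' : x ∈ s ∧ x ∈ t := by
      constructor
      · exact (Finset.mem_sdiff.mp hxs).1
      · exact (Finset.mem_sdiff.mp hxt).1
    rcases F.laminar s hs t ht (Finset.not_disjoint_iff.mpr ⟨x, hxs'.1, hxs'.2⟩) with hst | hts
    · exact Or.inl (key s hs t ht hst x hxs hxt)
    · exact Or.inr (key t ht s hs hts x hxt hxs)
  singleton_mem := by
    intro x
    have hU : ((D.filter fun d => d ∈ F.clusters).filter fun d => d ⊂ ({x} : Finset X)) = ∅ := by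
      rw [Finset.filter_eq_empty_iff]
      intro d hd hss
      have hne := F.nonempty_of_mem d (Finset.mem_filter.mp hd).2
      rw [Finset.ssubset_singleton_iff.mp hss] at hne
      exact Finset.not_nonempty_empty hne
    refine Finset.mem_filter.mpr ⟨?_, Finset.singleton_nonempty x⟩
    refine Finset.mem_image.mpr ⟨{x}, F.singleton_mem x, ?_⟩
    rw [hU]
    simp

/-- `G` is a subforest of `F` (up to forced contraction and label-preserving
isomorphism): `G` is obtained from `F` by removing a set of edges. -/
def IsSubforest (G F : XForest X) : Prop :=
  ∃ D ⊆ F.clusters, G.clusters = (F.cut D).clusters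

/-- The edge of `F` between the vertex with cluster `c` and its parent is *in*
the forest `G` (i.e. it lies on a path of `F` connecting two labels that belong
to a common connected component of `G`). -/
def EdgeUsed (F : XForest X) (c : Finset X) (G : XForest X) : Prop :=
  ∃ x ∈ c, ∃ y, y ∉ c ∧ (∃ C ∈ F.components, x ∈ C ∧ y ∈ C) ∧
    ∃ D ∈ G.components, x ∈ D ∧ y ∈ D

/-- The least common ancestor of the two labels `a` and `b` in `F` (given as
its cluster, i.e. as the label set `L(lca_F(a,b))`). -/
def lca2 (F : XForest X) (a b : X) : Finset X :=
  (F.clusters.filter fun s => a ∈ s ∧ b ∈ s).inf id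

/-- The least common ancestor of the labels of `S` in `F` (given as its
cluster). -/
def lcaS (F : XForest X) (S : Finset X) : Finset X :=
  (F.clusters.filter fun s => S ⊆ s).inf id

/-- `E^1_F(a,b)`: the edges of `F` that are not on the path `P` connecting the
labels `a` and `b` but are incident to internal vertices of this path other
than `lca_F(a,b)` (each edge is identified with the cluster of its lower
endpoint). -/
def E1 (F : XForest X) (a b : X) : Finset (Finset X) :=
  F.clusters.filter fun d => ∃ c ∈ F.clusters, F.IsChild d c ∧ c ⊂ F.lca2 a b ∧
    ((a ∈ c ∧ c ≠ {a} ∧ a ∉ d) ∨ (b ∈ c ∧ c ≠ {b} ∧ b ∉ d))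

/-- `E^2_F(a,b)`: the edges incident to `lca_F(a,b)` other than the two edges
on the path connecting `a` and `b` and the edge to the parent of the lca. -/
def E2 (F : XForest X) (a b : X) : Finset (Finset X) :=
  F.clusters.filter fun d => F.IsChild d (F.lca2 a b) ∧ a ∉ d ∧ b ∉ d

/-- `E_F(a,b) = E^1_F(a,b) ∪ E^2_F(a,b)`. -/
def Eset (F : XForest X) (a b : X) : Finset (Finset X) := F.E1 a b ∪ F.E2 a b

/-- `E^O_F(S)`: the edges between `lca_F(S)` and its children that are not
labels in `S`. -/
def EO (F : XForest X) (S : Finset X) : Finset (Finset X) :=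
  F.clusters.filter fun d => F.IsChild d (F.lcaS S) ∧ ∀ x ∈ S, d ≠ {x}

/-- `S` is a maximal sibling set (MSS) of `F`: the leaves with labels in `S`
have a common parent `p` whose children are exactly the labels in `S`
(equivalently, `S` itself is a cluster all of whose proper subclusters are
singletons). -/
def IsMSS (F : XForest X) (S : Finset X) : Prop :=
  S ∈ F.clusters ∧ 2 ≤ S.card ∧ ∀ c ∈ F.clusters, c ⊂ S → c.card = 1

/-- the labels in `S` are (pairwise) siblings in `F`, i.e., they have a common
parent. -/
def Siblings (F : XForest X) (S : Finset X) : Prop :=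
  ∃ p ∈ F.clusters, ∀ x ∈ S, F.IsChild {x} p

/-- An `X`-forest is binary if each of its non-leaf vertices has exactly two
children. -/
def IsBinary (F : XForest X) : Prop :=
  ∀ s ∈ F.clusters, 2 ≤ s.card → ∃ c₁ c₂ : Finset X, c₁ ≠ c₂ ∧
    F.IsChild c₁ s ∧ F.IsChild c₂ s ∧ ∀ c, F.IsChild c s → c = c₁ ∨ c = c₂

/-- `B` is a resolution of `F`: `F` can be obtained from `B` by contracting
internal edges. -/
def IsResolution (B F : XForest X) : Prop :=
  F.clusters ⊆ B.clusters ∧ B.components = F.components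

/-- `G` is a binary subforest of `F`: `G` is binary and is a subforest of some
binary resolution of `F`. -/
def IsBinarySubforest (G F : XForest X) : Prop :=
  G.IsBinary ∧ ∃ B : XForest X, B.IsBinary ∧ IsResolution B F ∧ IsSubforest G B

end XForest

variable {X : Type*} [DecidableEq X] [Fintype X] {m : ℕ}

/-- A hard agreement forest for the `X`-forests `Fs`. -/
def IsHAF (Fs : Fin m → XForest X) (G : XForest X) : Prop :=
  ∀ i, XForest.IsSubforest G (Fs i)

/-- A hard maximum agreement forest (hMAF) for the `X`-forests `Fs`. -/
def IsHMAF (Fs : Fin m → XForest X) (G : XForest X) : Prop :=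
  IsHAF Fs G ∧ ∀ G', IsHAF Fs G' → G.ord ≤ G'.ord

/-- A soft agreement forest for the `X`-forests `Fs`. -/
def IsSAF (Fs : Fin m → XForest X) (G : XForest X) : Prop :=
  ∀ i, XForest.IsBinarySubforest G (Fs i)

/-- A soft maximum agreement forest (sMAF) for the `X`-forests `Fs`. -/
def IsSMAF (Fs : Fin m → XForest X) (G : XForest X) : Prop :=
  IsSAF Fs G ∧ ∀ G', IsSAF Fs G' → G.ord ≤ G'.ord

/-- An instance `(F_1, …, F_m; k)` of the (hard or soft) Maf problem. -/
structure Inst (X : Type*) (m : ℕ) where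
  F : Fin m → XForest X
  k : ℤ

namespace Inst

/-- the largest order of an `X`-forest in the instance. -/
def ordMax (I : Inst X m) : ℕ := Finset.univ.sup fun i => (I.F i).ord

/-- a solution of an instance of the hMaf problem: a hard agreement forest
whose order is at most `ordMax + k`. -/
def IsSolution (I : Inst X m) (G : XForest X) : Prop :=
  IsHAF I.F G ∧ (G.ord : ℤ) ≤ (I.ordMax : ℤ) + I.k

/-- a yes-instance of the hMaf problem. -/
def IsYes (I : Inst X m) : Prop := ∃ G, I.IsSolution G

/-- a solution of an instance of the sMaf problem. -/
def IsSSolution (I : Inst X m) (G : XForest X) : Prop :=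
  IsSAF I.F G ∧ (G.ord : ℤ) ≤ (I.ordMax : ℤ) + I.k

/-- a yes-instance of the sMaf problem. -/
def IsSYes (I : Inst X m) : Prop := ∃ G, I.IsSSolution G

/-- `S` is a minimum maximal sibling set of the instance `I`, lying in the
`i`-th forest. -/
def MinMSS (I : Inst X m) (i : Fin m) (S : Finset X) : Prop :=
  (I.F i).IsMSS S ∧ ∀ j : Fin m, ∀ S' : Finset X, (I.F j).IsMSS S' → S.card ≤ S'.card

end Inst

/-- the new value of the parameter after removing one edge from the `j`-th
forest (the maximum order `ordMax + k` stays invariant). -/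
def cutk (I : Inst X m) (j : Fin m) : ℤ :=
  if (I.F j).ord = I.ordMax then I.k - 1 else I.k

/-- Reduction Rule 1 is applicable on `Fj` relative to `Fi`, at the vertex `v`
of `Fj` (whose parent edge is to be removed): there is a subset
`{C_1, …, C_t}` (`t ≥ 1`) of the components of `Fi` and a component `C` of
`Fj` containing a non-root vertex `v` with
`L(v) = L(C) ∩ (L(C_1) ∪ … ∪ L(C_t))`. -/
def RR1App (Fi Fj : XForest X) (v : Finset X) : Prop :=
  ∃ 𝒞 ⊆ Fi.components, 𝒞.Nonempty ∧
    ∃ C ∈ Fj.components, v ∈ Fj.clusters ∧ v ⊆ C ∧ (∃ t ∈ Fj.clusters, v ⊂ t) ∧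
      v = C ∩ 𝒞.biUnion id

/-- One application of Reduction Rule 1 to the instance `I`, producing `I'`. -/
def RR1Step (I I' : Inst X m) : Prop :=
  ∃ i j, i ≠ j ∧ ∃ v, RR1App (I.F i) (I.F j) v ∧
    I' = ⟨Function.update I.F j ((I.F j).cut {v}), cutk I j⟩

/-- Reduction Rule 1 is applicable somewhere on the instance `I`. -/
def RR1Applicable (I : Inst X m) : Prop :=
  ∃ i j, i ≠ j ∧ ∃ v, RR1App (I.F i) (I.F j) v

/-- `I'` is obtained from `I` by applying Reduction Rule 1 repeatedly until it
is no longer applicable. -/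
def RR1Exhaust (I I' : Inst X m) : Prop :=
  Relation.ReflTransGen RR1Step I I' ∧ ¬RR1Applicable I'

/-- The situation of Case 1 (Branching Rule 1) for `Fj` relative to `Fi`:
there is a component `C` of `Fi` and a vertex `v` of `Fj` with two children
`c₁, c₂` such that `L(c₁) ⊆ L(C)` and `L(c₂) ∩ L(C) = ∅`. -/
def BR1AppCore (Fi Fj : XForest X) (v c₁ c₂ : Finset X) : Prop :=
  ∃ C ∈ Fi.components, Fj.IsChild c₁ v ∧ Fj.IsChild c₂ v ∧ c₁ ≠ c₂ ∧
    c₁ ⊆ C ∧ c₂ ∩ C = ∅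

/-- An application of Branching Rule 1 to the instance `I` (on the forest with
index `j`, relative to the forest with index `i`), branching into the two
instances `I₁` (removing `[v,c₁]`) and `I₂` (removing `[v,c₂]`). -/
def BR1Branch (I : Inst X m) (i j : Fin m) (v c₁ c₂ : Finset X)
    (I₁ I₂ : Inst X m) : Prop :=
  i ≠ j ∧ BR1AppCore (I.F i) (I.F j) v c₁ c₂ ∧
    I₁ = ⟨Function.update I.F j ((I.F j).cut {c₁}), cutk I j⟩ ∧
    I₂ = ⟨Function.update I.F j ((I.F j).cut {c₂}), cutk I j⟩

/-- two `X`-forests satisfy the label-set isomorphism property. -/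
def LabelIso (F F' : XForest X) : Prop := F.components = F'.components

/-- an instance satisfies the label-set isomorphism property. -/
def InstLabelIso (I : Inst X m) : Prop := ∀ i j, LabelIso (I.F i) (I.F j)

/-- One computation path of the 2-BR-process on the forests with indices `p`
and `q`: repeatedly apply Branching Rule 1 between these two forests (choosing
one of the two branches) followed by an exhaustive application of Reduction
Rule 1, until the two forests satisfy the label-set isomorphism property.  The
natural number records the number of edges removed by Branching Rule 1 along
the path. -/
inductive TwoBRPath {X : Type*} [DecidableEq X] [Fintype X] {m : ℕ} (p q : Fin m) :
    Inst X m → Inst X m → ℕ → Prop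
  | done (I : Inst X m) (h : LabelIso (I.F p) (I.F q)) : TwoBRPath p q I I 0
  | step {I I₁ I₂ J K I' : Inst X m} {n : ℕ} {i j : Fin m} {v c₁ c₂ : Finset X}
      (hij : (i = p ∧ j = q) ∨ (i = q ∧ j = p))
      (hbr : BR1Branch I i j v c₁ c₂ I₁ I₂)
      (hpick : J = I₁ ∨ J = I₂)
      (hex : RR1Exhaust J K)
      (hrest : TwoBRPath p q K I' n) : TwoBRPath p q I I' (n + 1)

/-- `s` and `t` are the indices of two forests with the first and the second
largest orders in `I`. -/
def FirstSecond (I : Inst X m) (s t : Fin m) : Prop :=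
  s ≠ t ∧ (∀ i, (I.F i).ord ≤ (I.F s).ord) ∧ ∀ i, i ≠ s → (I.F i).ord ≤ (I.F t).ord

/-- One computation path of Stage 2 of the m-BR-process: repeatedly apply the
2-BR-process to two forests with first and second largest orders not
satisfying the label-set isomorphism property, until the whole instance
satisfies the label-set isomorphism property. -/
inductive MBRAux {X : Type*} [DecidableEq X] [Fintype X] {m : ℕ} :
    Inst X m → Inst X m → ℕ → Prop
  | done (I : Inst X m) (h : InstLabelIso I) : MBRAux I I 0
  | step {I J I' : Inst X m} {a b : ℕ} {s t : Fin m}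
      (hst : FirstSecond I s t) (hni : ¬LabelIso (I.F s) (I.F t))
      (h2 : TwoBRPath s t I J a) (hrest : MBRAux J I' b) : MBRAux I I' (a + b)

/-- One computation path of the m-BR-process on the instance `I`, ending at
the instance `I'`, along which `n` edges are removed by Branching Rule 1. -/
def MBRPath (I I' : Inst X m) (n : ℕ) : Prop :=
  ∃ J, RR1Exhaust I J ∧ MBRAux J I' n

/-- The full branching tree of the 2-BR-process on the forests with indices
`p` and `q`, producing the collection (list) of resulting instances, each
together with the number of edges removed by Branching Rule 1 on its
computation path. -/
inductive TwoBRTree {X : Type*} [DecidableEq X] [Fintype X] {m : ℕ} (p q : Fin m) :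
    Inst X m → List (Inst X m × ℕ) → Prop
  | done (I : Inst X m) (h : LabelIso (I.F p) (I.F q)) : TwoBRTree p q I [(I, 0)]
  | step {I I₁ I₂ K₁ K₂ : Inst X m} {L₁ L₂ : List (Inst X m × ℕ)}
      {i j : Fin m} {v c₁ c₂ : Finset X}
      (hij : (i = p ∧ j = q) ∨ (i = q ∧ j = p))
      (hbr : BR1Branch I i j v c₁ c₂ I₁ I₂)
      (he₁ : RR1Exhaust I₁ K₁) (he₂ : RR1Exhaust I₂ K₂)
      (h₁ : TwoBRTree p q K₁ L₁) (h₂ : TwoBRTree p q K₂ L₂) :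
      TwoBRTree p q I ((L₁ ++ L₂).map fun x => (x.1, x.2 + 1))

/-- One step of Stage 2 of the m-BR-process on a collection of instances:
replace an instance, in which two forests of first and second largest orders
do not satisfy the label-set isomorphism property, by the collection produced
by the 2-BR-process on those two forests. -/
inductive CollStep {X : Type*} [DecidableEq X] [Fintype X] {m : ℕ} :
    List (Inst X m × ℕ) → List (Inst X m × ℕ) → Prop
  | step {I : Inst X m} {n : ℕ} {A B L : List (Inst X m × ℕ)} {s t : Fin m}
      (hst : FirstSecond I s t) (hni : ¬LabelIso (I.F s) (I.F t))
      (h : TwoBRTree s t I L) :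
      CollStep (A ++ (I, n) :: B) (A ++ L.map (fun y => (y.1, y.2 + n)) ++ B)

/-- The m-BR-process on the instance `I` produces the collection `L` of
instances (each recorded with the number of edges removed by Branching Rule 1
on the path leading to it): Stage 1 applies Reduction Rule 1 exhaustively, and
Stage 2 repeatedly applies the 2-BR-process until every instance of the
collection satisfies the label-set isomorphism property. -/
def MBRTree (I : Inst X m) (L : List (Inst X m × ℕ)) : Prop :=
  ∃ J, RR1Exhaust I J ∧ Relation.ReflTransGen CollStep [(J, 0)] L ∧
    ∀ x ∈ L, InstLabelIso x.1

/-- The 2-edge distance property of an instance. -/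
def TwoEdgeDist (I : Inst X m) : Prop :=
  ∃ (G : Inst X m) (E : Fin m → Finset (Finset X)),
    InstLabelIso G ∧ G.k = I.k + 1 ∧
    (∀ i, E i ⊆ (G.F i).clusters) ∧ (∀ i, (E i).card ≤ 1) ∧
    (∀ i, ∀ v ∈ E i, ∃ t ∈ (G.F i).clusters, v ⊂ t) ∧
    (∀ i, (I.F i).clusters = ((G.F i).cut (E i)).clusters) ∧
    ∃ i j : Fin m, i < j ∧ ∃ vi ∈ E i, ∃ vj ∈ E j, vi ≠ vj

/-- A branching step producing instances with parameters `ks` from an instance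
with parameter `k` satisfies the recurrence relation
`T(k) ≤ c₁·T(k-1) + c₂·T(k-2)`:  for every nonnegative monotone `T` satisfying
the recurrence, the sum of the `T`-values of the produced parameters is at
most `T k`. -/
def RecBound (k : ℤ) (ks : List ℤ) (c₁ c₂ : ℕ) : Prop :=
  ∀ T : ℤ → ℝ, (∀ x, 0 ≤ T x) → Monotone T →
    (∀ x : ℤ, (c₁ : ℝ) * T (x - 1) + (c₂ : ℝ) * T (x - 2) ≤ T x) →
    (ks.map T).sum ≤ T k

end

namespace RR1
open XForest

section
variable {X : Type*} [DecidableEq X] [Fintype X]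

lemma mem_cut (F : XForest X) (D : Finset (Finset X)) (s : Finset X) :
    s ∈ (F.cut D).clusters ↔ s.Nonempty ∧ ∃ t ∈ F.clusters,
      ∀ x, x ∈ s ↔ x ∈ t ∧ ∀ d ∈ D, d ∈ F.clusters → d ⊂ t → x ∉ d := by
  unfold XForest.cut XForest.cutFam
  simp only [Finset.mem_filter, Finset.mem_image]
  rw [and_comm]
  refine and_congr_right fun _ => exists_congr fun t => and_congr_right fun _ => ?_
  rw [Finset.ext_iff]
  refine forall_congr' fun x => ?_
  simp only [Finset.mem_sdiff, Finset.mem_biUnion, Finset.mem_filter, id]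
  constructor
  · intro h
    rw [← h]
    simp only [not_exists, not_and, and_imp]
  · intro h
    rw [h]
    simp only [not_exists, not_and, and_imp]

/-- image of a cluster under cutting at `v` -/
def phi (v t : Finset X) : Finset X := t.filter fun x => v ⊂ t → x ∉ v

lemma mem_phi (v t : Finset X) (x : X) : x ∈ phi v t ↔ x ∈ t ∧ (v ⊂ t → x ∉ v) := by
  simp [phi]

lemma phi_nonempty (F : XForest X) {v t : Finset X} (ht : t ∈ F.clusters) :
    (phi v t).Nonempty := by
  by_cases h : v ⊂ t
  · obtain ⟨x, hx, hxv⟩ := Finset.exists_of_ssubset h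
    exact ⟨x, (mem_phi _ _ _).2 ⟨hx, fun _ => hxv⟩⟩
  · obtain ⟨x, hx⟩ := F.nonempty_of_mem t ht
    exact ⟨x, (mem_phi _ _ _).2 ⟨hx, fun h' => absurd h' h⟩⟩

lemma mem_cut_single (F : XForest X) {v : Finset X} (hv : v ∈ F.clusters) (s : Finset X) :
    s ∈ (F.cut {v}).clusters ↔ ∃ t ∈ F.clusters, s = phi v t := by
  rw [mem_cut]
  constructor
  · rintro ⟨-, t, ht, h⟩
    refine ⟨t, ht, ?_⟩
    ext x
    rw [h, mem_phi]
    simp [hv]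
  · rintro ⟨t, ht, rfl⟩
    refine ⟨phi_nonempty F ht, t, ht, fun x => ?_⟩
    rw [mem_phi]
    simp [hv]

lemma phi_of_ss {v t : Finset X} (h : v ⊂ t) : phi v t = t \ v := by
  ext x; simp [mem_phi, h]

lemma phi_of_not {v t : Finset X} (h : ¬ v ⊂ t) : phi v t = t := by
  ext x; simp [mem_phi, h]

lemma phi_sub (v t : Finset X) : phi v t ⊆ t := fun x hx => ((mem_phi _ _ _).1 hx).1

lemma ss_of_phi_ss (F : XForest X) {v d t : Finset X} (hv : v ∈ F.clusters)
    (hd : d ∈ F.clusters) (ht : t ∈ F.clusters) (h : phi v d ⊂ phi v t) : d ⊂ t := by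
  have hne := phi_nonempty F (v := v) hd
  obtain ⟨x, hx⟩ := hne
  have hxd := phi_sub _ _ hx
  have hxt := phi_sub _ _ (h.1 hx)
  rcases F.laminar d hd t ht (Finset.not_disjoint_iff.2 ⟨x, hxd, hxt⟩) with h1 | h1
  · refine Finset.ssubset_iff_subset_ne.2 ⟨h1, ?_⟩
    rintro rfl
    exact (ssubset_irrefl _ h)
  · exfalso
    by_cases hvt : v ⊂ t
    · have hvd : v ⊂ d := lt_of_lt_of_le hvt h1
      rw [phi_of_ss hvt, phi_of_ss hvd] at h
      exact h.2 (Finset.sdiff_subset_sdiff h1 (subset_refl _))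
    · rw [phi_of_not hvt] at h
      by_cases hvd : v ⊂ d
      · rw [phi_of_ss hvd] at h hx
        obtain ⟨y, hy, hyn⟩ := Finset.exists_of_ssubset h
        have hyv : y ∈ v := by
          by_contra hc
          exact hyn (Finset.mem_sdiff.2 ⟨h1 hy, hc⟩)
        rcases F.laminar v hv t ht (Finset.not_disjoint_iff.2 ⟨y, hyv, hy⟩) with h2 | h2
        · have : v = t := by
            by_contra hc
            exact hvt (Finset.ssubset_iff_subset_ne.2 ⟨h2, hc⟩)
          subst this
          exact (Finset.mem_sdiff.1 hx).2 hxt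
        · exact (Finset.mem_sdiff.1 hx).2 (h2 hxt)
      · rw [phi_of_not hvd] at h
        exact h.2 h1

lemma phi_mono {v d t : Finset X} {x : X} (h : d ⊆ t) (hx : x ∈ phi v t) (hxd : x ∈ d) :
    x ∈ phi v d := by
  rw [mem_phi] at hx ⊢
  exact ⟨hxd, fun hv => hx.2 (lt_of_lt_of_le hv h)⟩

lemma phi_ss_or (F : XForest X) {v d t : Finset X} (hv : v ∈ F.clusters)
    (hd : d ∈ F.clusters) (h : d ⊂ t) {x : X} (hx : x ∈ phi v t) (hxd : x ∈ d) :
    phi v d ⊂ phi v t ∨ phi v d = phi v t := by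
  have hsub : phi v d ⊆ phi v t := by
    intro y hy
    rw [mem_phi] at hy ⊢
    refine ⟨h.1 hy.1, fun hvt hyv => ?_⟩
    rcases F.laminar v hv d hd (Finset.not_disjoint_iff.2 ⟨y, hyv, hy.1⟩) with h2 | h2
    · have : v = d := by
        by_contra hc
        exact hy.2 (Finset.ssubset_iff_subset_ne.2 ⟨h2, hc⟩) hyv
      subst this
      exact ((mem_phi _ _ _).1 hx).2 hvt hxd
    · exact ((mem_phi _ _ _).1 hx).2 hvt (h2 hxd)
  by_cases he : phi v d = phi v t
  · exact Or.inr he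
  · exact Or.inl (Finset.ssubset_iff_subset_ne.2 ⟨hsub, he⟩)

lemma not_ss_of_phi_eq {v d t : Finset X} (h : d ⊂ t) (he : phi v d = phi v t) :
    ¬ v ⊂ d := by
  intro hvd
  have hvt : v ⊂ t := lt_trans hvd h
  rw [phi_of_ss hvd, phi_of_ss hvt] at he
  apply h.2
  intro y hy
  by_cases hyv : y ∈ v
  · exact hvd.1 hyv
  · have : y ∈ t \ v := Finset.mem_sdiff.2 ⟨hy, hyv⟩
    rw [← he] at this
    exact (Finset.mem_sdiff.1 this).1

lemma cut_cut (F : XForest X) {v : Finset X} (hv : v ∈ F.clusters)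
    {D E : Finset (Finset X)} (hD : D ⊆ F.clusters)
    (hE : ∀ e, e ∈ E ↔ ∃ d ∈ D, e = phi v d) :
    ((F.cut {v}).cut E).clusters = (F.cut (insert v D)).clusters := by
  have good : ∀ t ∈ F.clusters, (∀ d ∈ D, d ⊂ t → phi v d ≠ phi v t) → ∀ x,
      (x ∈ phi v t ∧ ∀ e ∈ E, e ∈ (F.cut {v}).clusters → e ⊂ phi v t → x ∉ e) ↔
      (x ∈ t ∧ ∀ d ∈ insert v D, d ∈ F.clusters → d ⊂ t → x ∉ d) := by
    intro t ht hne x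
    constructor
    · rintro ⟨hx, h⟩
      refine ⟨phi_sub _ _ hx, ?_⟩
      intro d hd hdF hdt hxd
      rcases Finset.mem_insert.1 hd with rfl | hd
      · exact ((mem_phi _ _ _).1 hx).2 hdt hxd
      · rcases phi_ss_or F hv hdF hdt hx hxd with h1 | h1
        · exact h _ ((hE _).2 ⟨d, hd, rfl⟩) ((mem_cut_single F hv _).2 ⟨d, hdF, rfl⟩) h1
            (phi_mono hdt.1 hx hxd)
        · exact hne d hd hdt h1
    · rintro ⟨hx, h⟩
      refine ⟨(mem_phi _ _ _).2 ⟨hx, fun hvt => h v (Finset.mem_insert_self _ _) hv hvt⟩, ?_⟩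
      intro e he _ het hxe
      obtain ⟨d, hd, rfl⟩ := (hE e).1 he
      exact h d (Finset.mem_insert_of_mem hd) (hD hd) (ss_of_phi_ss F hv (hD hd) ht het)
        (phi_sub _ _ hxe)
  ext s
  rw [mem_cut, mem_cut]
  refine and_congr_right fun hs => ?_
  constructor
  · rintro ⟨t', ht', h⟩
    obtain ⟨t, ht, rfl⟩ := (mem_cut_single F hv _).1 ht'
    by_cases hne : ∀ d ∈ D, d ⊂ t → phi v d ≠ phi v t
    · exact ⟨t, ht, fun x => (h x).trans (good t ht hne x)⟩
    · push Not at hne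
      obtain ⟨d, hd, hdt, he⟩ := hne
      have hvd := not_ss_of_phi_eq hdt he
      refine ⟨d, hD hd, fun x => (h x).trans ?_⟩
      rw [← he]
      refine good d (hD hd) ?_ x
      intro d2 hd2 hd2d he2
      have hvd2 := not_ss_of_phi_eq hd2d he2
      rw [phi_of_not hvd, phi_of_not hvd2] at he2
      exact hd2d.ne he2
  · rintro ⟨t, ht, h⟩
    refine ⟨phi v t, (mem_cut_single F hv _).2 ⟨t, ht, rfl⟩, fun x => (h x).trans ?_⟩
    refine (good t ht ?_ x).symm
    intro d hd hdt he
    obtain ⟨y, hy⟩ := hs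
    obtain ⟨hyt, hy2⟩ := (h y).1 hy
    have : y ∈ phi v t :=
      (mem_phi _ _ _).2 ⟨hyt, fun hvt => hy2 v (Finset.mem_insert_self _ _) hv hvt⟩
    rw [← he] at this
    exact hy2 d (Finset.mem_insert_of_mem hd) (hD hd) hdt (phi_sub _ _ this)

lemma cut_insert (F : XForest X) {v : Finset X} (hv : v ∈ F.clusters)
    {D : Finset (Finset X)}
    (hcross : ∀ s ∈ (F.cut D).clusters, ∀ x ∈ s, x ∈ v → s ⊆ v) :
    (F.cut (insert v D)).clusters = (F.cut D).clusters := by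
  ext s
  constructor
  · intro hs
    obtain ⟨hne, t, ht, h⟩ := (mem_cut _ _ _).1 hs
    -- the old set
    let s0 : Finset X := t.filter fun x => ∀ d ∈ D, d ∈ F.clusters → d ⊂ t → x ∉ d
    have hs0 : ∀ x, x ∈ s0 ↔ x ∈ t ∧ ∀ d ∈ D, d ∈ F.clusters → d ⊂ t → x ∉ d := by
      intro x; simp [s0]
    obtain ⟨y, hy⟩ := hne
    have hys0 : y ∈ s0 := (hs0 y).2 ⟨((h y).1 hy).1, fun d hd =>
      ((h y).1 hy).2 d (Finset.mem_insert_of_mem hd)⟩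
    have hm : s0 ∈ (F.cut D).clusters := (mem_cut _ _ _).2 ⟨⟨y, hys0⟩, t, ht, hs0⟩
    suffices s = s0 by rwa [this]
    ext x
    rw [h, hs0]
    constructor
    · rintro ⟨h1, h2⟩
      exact ⟨h1, fun d hd => h2 d (Finset.mem_insert_of_mem hd)⟩
    · rintro ⟨h1, h2⟩
      refine ⟨h1, fun d hd hdF hdt hxd => ?_⟩
      rcases Finset.mem_insert.1 hd with rfl | hd
      · have := hcross s0 hm x ((hs0 x).2 ⟨h1, h2⟩) hxd
        exact ((h y).1 hy).2 d (Finset.mem_insert_self _ _) hdF hdt (this hys0)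
      · exact h2 d hd hdF hdt hxd
  · intro hs
    obtain ⟨hne, t, ht, h⟩ := (mem_cut _ _ _).1 hs
    refine (mem_cut _ _ _).2 ⟨hne, ?_⟩
    by_cases hc : v ⊂ t ∧ ∃ x ∈ s, x ∈ v
    · obtain ⟨hvt, x, hx, hxv⟩ := hc
      have hsv := hcross s hs x hx hxv
      refine ⟨v, hv, fun y => ?_⟩
      constructor
      · intro hy
        refine ⟨hsv hy, fun d hd hdF hdv => ?_⟩
        rcases Finset.mem_insert.1 hd with rfl | hd
        · exact absurd hdv (ssubset_irrefl _)
        · exact ((h y).1 hy).2 d hd hdF (hdv.trans hvt)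
      · rintro ⟨hyv, hy⟩
        refine (h y).2 ⟨hvt.1 hyv, fun d hd hdF hdt hyd => ?_⟩
        rcases F.laminar d hdF v hv (Finset.not_disjoint_iff.2 ⟨y, hyd, hyv⟩) with h1 | h1
        · by_cases hdv : d = v
          · subst hdv
            exact ((h x).1 hx).2 d hd hdF hdt hxv
          · exact hy d (Finset.mem_insert_of_mem hd) hdF
              (Finset.ssubset_iff_subset_ne.2 ⟨h1, hdv⟩) hyd
        · exact ((h x).1 hx).2 d hd hdF hdt (h1 hxv)
    · refine ⟨t, ht, fun y => ?_⟩
      rw [h]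
      constructor
      · rintro ⟨h1, h2⟩
        refine ⟨h1, fun d hd hdF hdt hyd => ?_⟩
        rcases Finset.mem_insert.1 hd with rfl | hd
        · exact hc ⟨hdt, y, (h y).2 ⟨h1, h2⟩, hyd⟩
        · exact h2 d hd hdF hdt hyd
      · rintro ⟨h1, h2⟩
        exact ⟨h1, fun d hd => h2 d (Finset.mem_insert_of_mem hd)⟩

lemma mem_comp (F : XForest X) (s : Finset X) :
    s ∈ F.components ↔ s ∈ F.clusters ∧ ∀ t ∈ F.clusters, ¬ s ⊂ t := by
  simp [XForest.components]

lemma sub_comp (F : XForest X) {s C : Finset X} (hs : s ∈ F.clusters) (hC : C ∈ F.components)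
    {x : X} (hx : x ∈ s) (hxC : x ∈ C) : s ⊆ C := by
  rw [mem_comp] at hC
  rcases F.laminar s hs C hC.1 (Finset.not_disjoint_iff.2 ⟨x, hx, hxC⟩) with h | h
  · exact h
  · by_contra hc
    exact hC.2 s hs ⟨h, hc⟩

lemma sub_of_subforest {F G : XForest X} (h : IsSubforest G F) {s : Finset X}
    (hs : s ∈ G.clusters) : ∃ t ∈ F.clusters, s ⊆ t := by
  obtain ⟨D, -, hD⟩ := h
  rw [hD] at hs
  obtain ⟨-, t, ht, h⟩ := (mem_cut _ _ _).1 hs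
  exact ⟨t, ht, fun x hx => ((h x).1 hx).1⟩

lemma subforest_of_cut {F G : XForest X} {v : Finset X} (hv : v ∈ F.clusters)
    (h : IsSubforest G (F.cut {v})) : IsSubforest G F := by
  classical
  obtain ⟨E, hE, hG⟩ := h
  refine ⟨insert v (F.clusters.filter fun d => phi v d ∈ E), ?_, ?_⟩
  · intro d hd
    rcases Finset.mem_insert.1 hd with rfl | hd
    · exact hv
    · exact (Finset.mem_filter.1 hd).1
  · rw [hG]
    refine cut_cut F hv (Finset.filter_subset _ _) fun e => ?_
    constructor
    · intro he
      obtain ⟨t, ht, rfl⟩ := (mem_cut_single F hv _).1 (hE he)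
      exact ⟨t, Finset.mem_filter.2 ⟨ht, he⟩, rfl⟩
    · rintro ⟨d, hd, rfl⟩
      exact (Finset.mem_filter.1 hd).2

lemma cut_of_subforest {Fi F G : XForest X} {v : Finset X} (happ : RR1App Fi F v)
    (hi : IsSubforest G Fi) (hj : IsSubforest G F) : IsSubforest G (F.cut {v}) := by
  classical
  obtain ⟨Cs, hCs, -, C, hC, hv, hvC, -, hveq⟩ := happ
  have hj' := hj
  obtain ⟨D, hD, hG⟩ := hj
  refine ⟨D.image (phi v), ?_, ?_⟩
  · intro e he
    obtain ⟨d, hd, rfl⟩ := Finset.mem_image.1 he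
    exact (mem_cut_single F hv _).2 ⟨d, hD hd, rfl⟩
  · rw [cut_cut F hv hD (fun e => by simp [eq_comm]), cut_insert F hv, hG]
    intro s hs x hx hxv
    rw [← hG] at hs
    obtain ⟨t, ht, hst⟩ := sub_of_subforest hj' hs
    obtain ⟨t', ht', hst'⟩ := sub_of_subforest hi hs
    have h1 := sub_comp F ht hC (hst hx) (hvC hxv)
    have hxu : x ∈ C ∩ Cs.biUnion id := by
      have := hxv; rw [hveq] at this
      simpa using this
    obtain ⟨C', hC', hxC'⟩ := Finset.mem_biUnion.1 (Finset.mem_inter.1 hxu).2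
    have h2 := sub_comp Fi ht' (hCs hC') (hst' hx) hxC'
    intro y hy
    have : y ∈ C ∩ Cs.biUnion id :=
      Finset.mem_inter.2 ⟨h1 (hst hy), Finset.mem_biUnion.2 ⟨C', hC', h2 (hst' hy)⟩⟩
    rw [hveq]
    simpa using this

lemma ord_cut (F : XForest X) {v C : Finset X} (hv : v ∈ F.clusters) (hC : C ∈ F.components)
    (hvC : v ⊂ C) : (F.cut {v}).ord = F.ord + 1 := by
  classical
  have hCF := ((mem_comp _ _).1 hC).1
  obtain ⟨x, hx⟩ := F.nonempty_of_mem v hv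
  obtain ⟨y, hyC, hyv⟩ := Finset.exists_of_ssubset hvC
  have hxC := hvC.1 hx
  have hK := mem_cut_single F hv
  have hvK : v ∈ (F.cut {v}).clusters :=
    (hK _).2 ⟨v, hv, (phi_of_not (ssubset_irrefl _)).symm⟩
  have hCK : C \ v ∈ (F.cut {v}).clusters := (hK _).2 ⟨C, hCF, (phi_of_ss hvC).symm⟩
  have hcomp : (F.cut {v}).components = insert v (insert (C \ v) (F.components.erase C)) := by
    have hvmax : v ∈ (F.cut {v}).components := by
      rw [mem_comp]
      refine ⟨hvK, fun t ht hvt => ?_⟩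
      obtain ⟨u, hu, rfl⟩ := (hK _).1 ht
      have := lt_of_lt_of_le hvt (phi_sub v u)
      rw [phi_of_ss this] at hvt
      exact (Finset.mem_sdiff.1 (hvt.1 hx)).2 hx
    have hCmax : C \ v ∈ (F.cut {v}).components := by
      rw [mem_comp]
      refine ⟨hCK, fun t ht hvt => ?_⟩
      obtain ⟨u, hu, rfl⟩ := (hK _).1 ht
      have hyu := hvt.1 (Finset.mem_sdiff.2 ⟨hyC, hyv⟩)
      have huC := sub_comp F hu hC (phi_sub _ _ hyu) hyC
      obtain ⟨z, hz, hzn⟩ := Finset.exists_of_ssubset hvt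
      have hzC := huC (phi_sub _ _ hz)
      have hzv : z ∈ v := by
        by_contra hc
        exact hzn (Finset.mem_sdiff.2 ⟨hzC, hc⟩)
      have := sub_comp (F.cut {v}) ht hvmax hz hzv
      exact hyv (this hyu)
    ext s
    simp only [Finset.mem_insert, Finset.mem_erase]
    constructor
    · intro hs
      obtain ⟨hsK, hsm⟩ := (mem_comp _ _).1 hs
      obtain ⟨t, ht, hst⟩ := (hK _).1 hsK
      by_cases hmeet : ∃ z ∈ s, z ∈ C
      · obtain ⟨z, hz, hzC⟩ := hmeet
        by_cases hzv : z ∈ v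
        · left
          exact (sub_comp _ hsK hvmax hz hzv).antisymm (sub_comp _ hvK hs hzv hz)
        · right; left
          have hzCv := Finset.mem_sdiff.2 ⟨hzC, hzv⟩
          exact (sub_comp _ hsK hCmax hz hzCv).antisymm (sub_comp _ hCK hs hzCv hz)
      · right; right
        have hnv : ¬ v ⊂ t := by
          intro hvt
          have htC := sub_comp F ht hC (hvt.1 hx) hxC
          obtain ⟨z, hz⟩ := (F.cut {v}).nonempty_of_mem s hsK
          exact hmeet ⟨z, hz, htC (phi_sub v t (hst ▸ hz))⟩
        rw [phi_of_not hnv] at hst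
        subst hst
        refine ⟨?_, (mem_comp _ _).2 ⟨ht, fun u hu hsu => ?_⟩⟩
        · rintro rfl
          exact hmeet ⟨x, hxC, hxC⟩
        · have hnvu : ¬ v ⊂ u := by
            intro hvu
            have huC := sub_comp F hu hC (hvu.1 hx) hxC
            obtain ⟨z, hz⟩ := F.nonempty_of_mem s ht
            exact hmeet ⟨z, hz, huC (hsu.1 hz)⟩
          exact hsm u ((hK _).2 ⟨u, hu, (phi_of_not hnvu).symm⟩) hsu
    · rintro (rfl | rfl | ⟨hsC, hs⟩)
      · exact hvmax
      · exact hCmax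
      · obtain ⟨hsF, hsm⟩ := (mem_comp _ _).1 hs
        have hnv : ¬ v ⊂ s := by
          intro hvs
          exact hsC ((sub_comp F hsF hC (hvs.1 hx) hxC).antisymm
            (sub_comp F hCF hs hxC (hvs.1 hx)))
        refine (mem_comp _ _).2 ⟨(hK _).2 ⟨s, hsF, (phi_of_not hnv).symm⟩, fun t ht hst => ?_⟩
        obtain ⟨u, hu, rfl⟩ := (hK _).1 ht
        exact hsm u hu (lt_of_lt_of_le hst (phi_sub v u))
  unfold XForest.ord
  rw [hcomp, Finset.card_insert_of_notMem, Finset.card_insert_of_notMem,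
    Finset.card_erase_of_mem hC]
  · have := Finset.card_pos.2 ⟨C, hC⟩
    omega
  · intro h
    obtain ⟨hne, h⟩ := Finset.mem_erase.1 h
    have := sub_comp F hCF h hyC (Finset.mem_sdiff.2 ⟨hyC, hyv⟩)
    exact (Finset.mem_sdiff.1 (this hxC)).2 hx
  · intro h
    rcases Finset.mem_insert.1 h with h | h
    · have hx' := hx
      rw [h] at hx'
      exact (Finset.mem_sdiff.1 hx').2 hx
    · exact ((mem_comp _ _).1 (Finset.mem_erase.1 h).2).2 C hCF hvC

end
end RR1

/-- Lemma 3.1.  If Reduction Rule 1 is applicable on `F_j`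
relative to `F_i` with edge `e` (the edge above the vertex `v`) removed from
`F_j`, producing the instance `(F_1, …, F_j ∖ {e}, …, F_m; k')` with
`k' = k - 1` if `Ord(F_j) = Ord_max` and `k' = k` otherwise, then the two
instances have exactly the same collection of solutions. -/
theorem statement_0 {X : Type*} [DecidableEq X] [Fintype X] {m : ℕ}
    (I I' : Inst X m) (i j : Fin m) (hij : i ≠ j) (v : Finset X)
    (happ : RR1App (I.F i) (I.F j) v)
    (hF : I'.F = Function.update I.F j ((I.F j).cut {v}))
    (hk : I'.k = if (I.F j).ord = I.ordMax then I.k - 1 else I.k) :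
    ∀ G : XForest X, I.IsSolution G ↔ I'.IsSolution G := by
  intro G
  have happ' := happ
  obtain ⟨Cs, hCs, -, C, hC, hv, hvC, ⟨t, ht, hvt⟩, hveq⟩ := happ'
  have hss : v ⊂ C := by
    refine Finset.ssubset_iff_subset_ne.2 ⟨hvC, ?_⟩
    rintro rfl
    exact ((RR1.mem_comp _ _).1 hC).2 t ht hvt
  have hord := RR1.ord_cut (I.F j) hv hC hss
  have hle : ∀ l, (I.F l).ord ≤ I.ordMax := fun l =>
    Finset.le_sup (f := fun i => (I.F i).ord) (Finset.mem_univ l)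
  have hle' : ∀ l, (I'.F l).ord ≤ I'.ordMax := fun l =>
    Finset.le_sup (f := fun i => (I'.F i).ord) (Finset.mem_univ l)
  have hFj : I'.F j = (I.F j).cut {v} := by rw [hF]; simp
  have hFl : ∀ l, l ≠ j → I'.F l = I.F l := by
    intro l hl; rw [hF]; simp [hl]
  have hub : ∀ n : ℕ, (∀ l, (I'.F l).ord ≤ n) → I'.ordMax ≤ n := fun n h =>
    Finset.sup_le fun l _ => h l
  have hub0 : ∀ n : ℕ, (∀ l, (I.F l).ord ≤ n) → I.ordMax ≤ n := fun n h =>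
    Finset.sup_le fun l _ => h l
  have hjle := hle j
  have hjle' := hle' j
  rw [hFj, hord] at hjle'
  have hmono : I.ordMax ≤ I'.ordMax := by
    refine hub0 _ fun l => ?_
    by_cases hl : l = j
    · subst hl; omega
    · rw [← hFl l hl]; exact hle' l
  have hsum : (I'.ordMax : ℤ) + I'.k = (I.ordMax : ℤ) + I.k := by
    rw [hk]
    split_ifs with hc
    · have : I'.ordMax ≤ I.ordMax + 1 := by
        refine hub _ fun l => ?_
        by_cases hl : l = j
        · subst hl; rw [hFj, hord]; omega
        · rw [hFl l hl]; have := hle l; omega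
      omega
    · have : I'.ordMax ≤ I.ordMax := by
        refine hub _ fun l => ?_
        by_cases hl : l = j
        · subst hl; rw [hFj, hord]; omega
        · rw [hFl l hl]; exact hle l
      omega
  unfold Inst.IsSolution
  rw [hsum]
  refine and_congr_left fun _ => ?_
  constructor
  · intro h l
    by_cases hl : l = j
    · subst hl
      rw [hFj]
      exact RR1.cut_of_subforest happ (h i) (h l)
    · rw [hFl l hl]; exact h l
  · intro h l
    by_cases hl : l = j
    · subst hl
      have := h l
      rw [hFj] at this
      exact RR1.subforest_of_cut hv this
    · have := h l
      rwa [hFl l hl] at this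
end

section
/- Branching Rule 1 is safe: for an instance (F_1,…,F_m;k) of the hMaf problem in the situation of Case 1, every hard agreement forest for {F_1,…,F_m} omits at least one of the edges [v,c_1] and [v,c_2] of F_j; consequently (F_1,…,F_m;k) is a yes-instance if and only if at least one of the two instances produced by Branching Rule 1 is a yes-instance. -/
/-!
A formalization framework for the Maximum Agreement Forest problem on multiple
rooted multifurcating phylogenetic trees.

An `X`-forest is modeled (up to forced contraction and label-preserving
isomorphism) by the laminar family of the label-sets `L(v)` of its vertices:
every vertex `v` is identified with the set `L(v)` of labels at its leaf
descendants, components correspond to the maximal clusters, leaves to the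
singleton clusters, and the edge between a non-root vertex `v` and its parent
is identified with the cluster `L(v)`.
-/

open Finset

namespace XForest

section helpers

variable {X : Type*} [DecidableEq X] [Fintype X]

theorem h_mem_comp (F : XForest X) (B : Finset X) :
    B ∈ F.components ↔ B ∈ F.clusters ∧ ∀ t ∈ F.clusters, B ⊆ t → t = B := by
  unfold components
  rw [Finset.mem_filter]
  refine and_congr_right fun _ => forall₂_congr fun t _ => ?_
  constructor
  · intro h hs
    by_contra hne
    exact h (Finset.ssubset_iff_subset_ne.mpr ⟨hs, fun e => hne e.symm⟩)
  · intro h hs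
    have := h hs.1
    subst this
    exact hs.2 (Finset.Subset.refl _)

theorem h_mem_cut (F : XForest X) (D : Finset (Finset X)) (z : Finset X) :
    z ∈ (F.cut D).clusters ↔ z.Nonempty ∧ ∃ s ∈ F.clusters, ∀ x, x ∈ z ↔
      x ∈ s ∧ ∀ d ∈ D, d ∈ F.clusters → d ⊂ s → x ∉ d := by
  unfold cut cutFam
  simp only [Finset.mem_filter, Finset.mem_image]
  rw [and_comm]
  refine and_congr_right fun _ => exists_congr fun s => and_congr_right fun _ => ?_
  rw [eq_comm, Finset.ext_iff]
  refine forall_congr' fun x => ?_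
  simp only [Finset.mem_sdiff, Finset.mem_biUnion, Finset.mem_filter, id]
  refine iff_congr Iff.rfl (and_congr_right fun _ => ?_)
  constructor
  · intro h d hd hF hs hx
    exact h ⟨d, ⟨⟨hd, hF⟩, hs⟩, hx⟩
  · rintro h ⟨d, ⟨⟨hd, hF⟩, hs⟩, hx⟩
    exact h d hd hF hs hx

theorem h_lam (F : XForest X) {s t : Finset X} (hs : s ∈ F.clusters) (ht : t ∈ F.clusters)
    {x : X} (h1 : x ∈ s) (h2 : x ∈ t) : s ⊆ t ∨ t ⊂ s := by
  rcases F.laminar s hs t ht (Finset.not_disjoint_iff.mpr ⟨x, h1, h2⟩) with h | h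
  · exact Or.inl h
  · by_cases e : s ⊆ t
    · exact Or.inl e
    · exact Or.inr ⟨h, e⟩

theorem h_exists_comp (F : XForest X) {s : Finset X} (hs : s ∈ F.clusters) :
    ∃ B ∈ F.components, s ⊆ B := by
  obtain ⟨B, hsB, hB⟩ := F.clusters.exists_le_maximal hs
  refine ⟨B, (h_mem_comp F B).mpr ⟨hB.1, fun t ht hBt => ?_⟩, hsB⟩
  exact Finset.Subset.antisymm (hB.2 ht hBt) hBt

theorem h_cover (F : XForest X) (x : X) : ∃ B ∈ F.components, x ∈ B := by
  obtain ⟨B, hB, h⟩ := h_exists_comp F (F.singleton_mem x)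
  exact ⟨B, hB, h (Finset.mem_singleton_self x)⟩

theorem h_sub_comp (F : XForest X) {s B : Finset X} (hs : s ∈ F.clusters)
    (hB : B ∈ F.components) {x : X} (h1 : x ∈ s) (h2 : x ∈ B) : s ⊆ B := by
  rw [h_mem_comp] at hB
  rcases h_lam F hs hB.1 h1 h2 with h | h
  · exact h
  · rw [hB.2 s hs h.1]

theorem h_comp_eq (F : XForest X) {A B : Finset X} (hA : A ∈ F.components)
    (hB : B ∈ F.components) {x : X} (h1 : x ∈ A) (h2 : x ∈ B) : A = B :=
  Finset.Subset.antisymm (h_sub_comp F ((h_mem_comp F A).mp hA).1 hB h1 h2)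
    (h_sub_comp F ((h_mem_comp F B).mp hB).1 hA h2 h1)

/-- the vertex `s` of `F` belongs to the subtree of `F` spanned by `B`. -/
def HUsed (F : XForest X) (s B : Finset X) : Prop :=
  (∃ x, x ∈ s ∧ x ∈ B) ∧ ∀ t ∈ F.clusters, t ⊂ s → ¬ B ⊆ t

/-- Intrinsic characterization of subforests. -/
structure HSubf (G F : XForest X) : Prop where
  c1 : ∀ B ∈ G.components, ∃ s ∈ F.clusters, B ⊆ s
  c2 : ∀ s ∈ F.clusters, ∀ B ∈ G.components, ∀ B' ∈ G.components,
    HUsed F s B → HUsed F s B' → B = B'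
  c3 : ∀ z, z ∈ G.clusters ↔ z.Nonempty ∧ ∃ s ∈ F.clusters, ∃ B ∈ G.components, z = s ∩ B

theorem HSubf.of_isSubforest {G F : XForest X} (h : IsSubforest G F) : HSubf G F := by
  obtain ⟨D, hD, hG⟩ := h
  have hm : ∀ z, z ∈ G.clusters ↔ z.Nonempty ∧ ∃ s ∈ F.clusters, ∀ x, x ∈ z ↔
      x ∈ s ∧ ∀ d ∈ D, d ⊂ s → x ∉ d := by
    intro z
    rw [hG, h_mem_cut]
    refine and_congr_right fun _ => exists_congr fun s => and_congr_right fun _ =>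
      forall_congr' fun x => iff_congr Iff.rfl (and_congr_right fun _ =>
        forall₂_congr fun d hd => ?_)
    exact ⟨fun h => h (hD hd), fun h _ => h⟩
  have hcl : ∀ B ∈ G.components, B ∈ G.clusters := fun B hB => ((h_mem_comp G B).mp hB).1
  -- key: if s ⊆ t, psi(t) = B is a component and x ∈ s ∩ B then s ∩ B is a cluster
  have key : ∀ s ∈ F.clusters, ∀ t ∈ F.clusters, s ⊆ t → ∀ B ∈ G.components,
      (∀ x, x ∈ B ↔ x ∈ t ∧ ∀ d ∈ D, d ⊂ t → x ∉ d) → ∀ x, x ∈ s → x ∈ B →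
      s ∩ B ∈ G.clusters ∧ ∀ y, y ∈ s ∩ B ↔ y ∈ s ∧ ∀ d ∈ D, d ⊂ s → y ∉ d := by
    intro s hs t ht hst B hB hBt x hxs hxB
    have h1 : ∀ y, y ∈ s → y ∈ B → ∀ d ∈ D, d ⊂ s → y ∉ d := fun y hys hyB d hd hds =>
      ((hBt y).mp hyB).2 d hd (lt_of_lt_of_le hds hst)
    classical
    let z : Finset X := s.filter fun y => ∀ d ∈ D, d ⊂ s → y ∉ d
    have hzm : ∀ y, y ∈ z ↔ y ∈ s ∧ ∀ d ∈ D, d ⊂ s → y ∉ d := fun y => Finset.mem_filter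
    have hxz : x ∈ z := (hzm x).mpr ⟨hxs, h1 x hxs hxB⟩
    have hz : z ∈ G.clusters := (hm z).mpr ⟨⟨x, hxz⟩, s, hs, hzm⟩
    have hzB : z ⊆ B := h_sub_comp G hz hB hxz hxB
    have e : s ∩ B = z := by
      ext y
      rw [Finset.mem_inter]
      constructor
      · rintro ⟨a, b⟩
        exact (hzm y).mpr ⟨a, h1 y a b⟩
      · intro hy
        exact ⟨((hzm y).mp hy).1, hzB hy⟩
    rw [e]
    exact ⟨hz, hzm⟩
  refine ⟨?_, ?_, ?_⟩
  · intro B hB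
    obtain ⟨-, s, hs, h⟩ := (hm B).mp (hcl B hB)
    exact ⟨s, hs, fun x hx => ((h x).mp hx).1⟩
  · intro s hs B hB B' hB' hu hu'
    have aux : ∀ B ∈ G.components, HUsed F s B →
        ∃ x ∈ B, x ∈ s ∧ s ∩ B ∈ G.clusters ∧
          ∀ y, y ∈ s ∩ B ↔ y ∈ s ∧ ∀ d ∈ D, d ⊂ s → y ∉ d := by
      intro B hB hu
      obtain ⟨⟨x, hxs, hxB⟩, hn⟩ := hu
      obtain ⟨-, t, ht, hBt⟩ := (hm B).mp (hcl B hB)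
      rcases h_lam F hs ht hxs ((hBt x).mp hxB).1 with h | h
      · exact ⟨x, hxB, hxs, key s hs t ht h B hB hBt x hxs hxB⟩
      · exact absurd (fun x hx => ((hBt x).mp hx).1) (hn t ht h)
    obtain ⟨x, hxB, hxs, -, h1⟩ := aux B hB hu
    obtain ⟨x', hxB', hxs', -, h2⟩ := aux B' hB' hu'
    have : x ∈ s ∩ B' := (h2 x).mpr ((h1 x).mp (Finset.mem_inter.mpr ⟨hxs, hxB⟩))
    exact h_comp_eq G hB hB' hxB (Finset.mem_inter.mp this).2
  · intro z
    constructor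
    · intro hz
      obtain ⟨hne, s, hs, hzs⟩ := (hm z).mp hz
      refine ⟨hne, ?_⟩
      obtain ⟨B, hB, hzB⟩ := h_exists_comp G hz
      obtain ⟨x, hx⟩ := hne
      obtain ⟨-, t, ht, hBt⟩ := (hm B).mp (hcl B hB)
      refine ⟨s, hs, B, hB, ?_⟩
      have hxs := (hzs x).mp hx
      have hxt := (hBt x).mp (hzB hx)
      rcases h_lam F hs ht hxs.1 hxt.1 with h | h
      · have := (key s hs t ht h B hB hBt x hxs.1 (hzB hx)).2
        ext y
        rw [this y, hzs y]
      · ext y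
        rw [Finset.mem_inter]
        refine ⟨fun hy => ⟨((hzs y).mp hy).1, hzB hy⟩, ?_⟩
        rintro ⟨hys, hyB⟩
        refine (hzs y).mpr ⟨hys, fun d hd hds hyd => ?_⟩
        have hyt := (hBt y).mp hyB
        rcases h_lam F ht (hD hd) hyt.1 hyd with h' | h'
        · exact hxs.2 d hd hds (h' hxt.1)
        · exact hyt.2 d hd h' hyd
    · rintro ⟨⟨x, hx⟩, s, hs, B, hB, rfl⟩
      obtain ⟨hxs, hxB⟩ := Finset.mem_inter.mp hx
      obtain ⟨-, t, ht, hBt⟩ := (hm B).mp (hcl B hB)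
      rcases h_lam F hs ht hxs ((hBt x).mp hxB).1 with h | h
      · exact (key s hs t ht h B hB hBt x hxs hxB).1
      · have : s ∩ B = B := Finset.inter_eq_right.mpr
          (fun y hy => h.1 ((hBt y).mp hy).1)
        rw [this]
        exact hcl B hB

theorem HSubf.isSubforest {G F : XForest X} (h : HSubf G F) : IsSubforest G F := by
  classical
  obtain ⟨c1, c2, c3⟩ := h
  let D : Finset (Finset X) := F.clusters.filter fun d =>
    ∀ B ∈ G.components, (∃ x, x ∈ B ∧ x ∈ d) → B ⊆ d
  have hDm : ∀ d, d ∈ D ↔ d ∈ F.clusters ∧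
    ∀ B ∈ G.components, (∃ x, x ∈ B ∧ x ∈ d) → B ⊆ d := fun d => Finset.mem_filter
  have hcl : ∀ B ∈ G.components, B ∈ G.clusters := fun B hB => ((h_mem_comp G B).mp hB).1
  -- minimal cluster containing B
  have hmin : ∀ B ∈ G.components, ∀ s ∈ F.clusters, B ⊆ s → ∃ t ∈ F.clusters, t ⊆ s ∧ B ⊆ t ∧
      HUsed F t B := by
    intro B hB s hs hBs
    have : s ∈ F.clusters.filter fun t => B ⊆ t := Finset.mem_filter.mpr ⟨hs, hBs⟩
    obtain ⟨t, hts, ht⟩ := Finset.exists_le_minimal _ this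
    have ht1 := Finset.mem_filter.mp ht.1
    obtain ⟨x, hx⟩ := G.nonempty_of_mem B (hcl B hB)
    refine ⟨t, ht1.1, hts, ht1.2, ⟨x, ht1.2 hx, hx⟩, fun u hu hut hBu => ?_⟩
    exact hut.2 (ht.2 (Finset.mem_filter.mpr ⟨hu, hBu⟩) hut.1)
  have hused : ∀ s ∈ F.clusters, ∀ x, x ∈ s → (∀ d ∈ D, d ⊂ s → x ∉ d) →
      ∀ B ∈ G.components, x ∈ B → HUsed F s B := by
    intro s hs x hxs hx B hB hxB
    refine ⟨⟨x, hxs, hxB⟩, fun t ht hts hBt => ?_⟩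
    obtain ⟨u, hu, hut, hBu, hU⟩ := hmin B hB t ht hBt
    have hus : u ⊂ s := lt_of_le_of_lt hut hts
    refine hx u ((hDm u).mpr ⟨hu, ?_⟩) hus (hBu hxB)
    rintro B' hB' ⟨y, hy, hyu⟩
    by_contra hcon
    have : HUsed F u B' := ⟨⟨y, hyu, hy⟩, fun w hw hwu hB'w => hcon (hB'w.trans hwu.1)⟩
    have e := c2 u hu B hB B' hB' hU this
    exact hcon (e ▸ hBu)
  have hpsi : ∀ s ∈ F.clusters, ∀ x, x ∈ s → (∀ d ∈ D, d ⊂ s → x ∉ d) →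
      ∀ B ∈ G.components, x ∈ B → ∀ y, y ∈ s ∩ B ↔ y ∈ s ∧ ∀ d ∈ D, d ⊂ s → y ∉ d := by
    intro s hs x hxs hx B hB hxB y
    rw [Finset.mem_inter]
    constructor
    · rintro ⟨hys, hyB⟩
      refine ⟨hys, fun d hd hds hyd => hx d hd hds ?_⟩
      exact ((hDm d).mp hd).2 B hB ⟨y, hyB, hyd⟩ hxB
    · rintro ⟨hys, hy⟩
      obtain ⟨B', hB', hyB'⟩ := h_cover G y
      have e := c2 s hs B hB B' hB' (hused s hs x hxs hx B hB hxB)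
        (hused s hs y hys hy B' hB' hyB')
      exact ⟨hys, e ▸ hyB'⟩
  have hDF : ∀ d ∈ D, d ∈ F.clusters := fun d hd => ((hDm d).mp hd).1
  refine ⟨D, hDF, ?_⟩
  ext z
  rw [h_mem_cut, c3]
  refine and_congr_right fun hne => ?_
  obtain ⟨x, hx⟩ := hne
  constructor
  · rintro ⟨s, hs, B, hB, rfl⟩
    obtain ⟨hxs, hxB⟩ := Finset.mem_inter.mp hx
    obtain ⟨t, ht, htB, hU⟩ : ∃ t ∈ F.clusters, s ∩ B = t ∩ B ∧ HUsed F t B := by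
      by_cases hBs : B ⊆ s
      · obtain ⟨t, ht, -, hBt, hU⟩ := hmin B hB s hs hBs
        exact ⟨t, ht, by rw [Finset.inter_eq_right.mpr hBs, Finset.inter_eq_right.mpr hBt], hU⟩
      · exact ⟨s, hs, rfl, ⟨x, hxs, hxB⟩, fun w hw hws hBw => hBs (hBw.trans hws.1)⟩
    rw [htB] at hx ⊢
    have hxt := (Finset.mem_inter.mp hx).1
    have hxx : ∀ d ∈ D, d ⊂ t → x ∉ d := by
      intro d hd hdt hxd
      exact hU.2 d (hDF d hd) hdt (((hDm d).mp hd).2 B hB ⟨x, hxB, hxd⟩)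
    refine ⟨t, ht, fun y => ?_⟩
    rw [hpsi t ht x hxt hxx B hB hxB y]
    exact and_congr_right fun _ => forall₂_congr fun d hd =>
      ⟨fun h _ => h, fun h => h (hDF d hd)⟩
  · rintro ⟨s, hs, hz⟩
    obtain ⟨B, hB, hxB⟩ := h_cover G x
    have hx' := (hz x).mp hx
    refine ⟨s, hs, B, hB, ?_⟩
    ext y
    rw [hpsi s hs x hx'.1 (fun d hd => hx'.2 d hd (hDF d hd)) B hB hxB y, hz y]
    exact and_congr_right fun _ => forall₂_congr fun d hd =>
      ⟨fun h => h (hDF d hd), fun h _ => h⟩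

theorem HSubf.trans {G H F : XForest X} (h1 : HSubf G H) (h2 : HSubf H F) : HSubf G F := by
  have hcl : ∀ B ∈ H.components, B ∈ H.clusters := fun B hB => ((h_mem_comp H B).mp hB).1
  have hup : ∀ B ∈ G.components, ∃ A ∈ H.components, B ⊆ A := by
    intro B hB
    obtain ⟨s, hs, hBs⟩ := h1.c1 B hB
    obtain ⟨A, hA, hsA⟩ := h_exists_comp H hs
    exact ⟨A, hA, hBs.trans hsA⟩
  refine ⟨?_, ?_, ?_⟩
  · intro B hB
    obtain ⟨A, hA, hBA⟩ := hup B hB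
    obtain ⟨s, hs, hAs⟩ := h2.c1 A hA
    exact ⟨s, hs, hBA.trans hAs⟩
  · intro s hs B hB B' hB' hu hu'
    obtain ⟨A, hA, hBA⟩ := hup B hB
    obtain ⟨A', hA', hBA'⟩ := hup B' hB'
    obtain ⟨⟨x, hxs, hxB⟩, hn⟩ := hu
    obtain ⟨⟨x', hxs', hxB'⟩, hn'⟩ := hu'
    have e : A = A' := h2.c2 s hs A hA A' hA'
      ⟨⟨x, hxs, hBA hxB⟩, fun t ht hts hAt => hn t ht hts (hBA.trans hAt)⟩
      ⟨⟨x', hxs', hBA' hxB'⟩, fun t ht hts hAt => hn' t ht hts (hBA'.trans hAt)⟩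
    subst e
    have hh : s ∩ A ∈ H.clusters := (h2.c3 _).mpr
      ⟨⟨x, Finset.mem_inter.mpr ⟨hxs, hBA hxB⟩⟩, s, hs, A, hA, rfl⟩
    have aux : ∀ B, B ⊆ A → HUsed F s B → HUsed H (s ∩ A) B := by
      rintro B hBA ⟨⟨x, hxs, hxB⟩, hn⟩
      refine ⟨⟨x, Finset.mem_inter.mpr ⟨hxs, hBA hxB⟩, hxB⟩, fun t' ht' hlt hBt => ?_⟩
      obtain ⟨-, t, ht, A2, hA2, rfl⟩ := (h2.c3 _).mp ht'
      have hx2 := Finset.mem_inter.mp (hBt hxB)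
      have e := h_comp_eq H hA2 hA hx2.2 (hBA hxB)
      subst e
      rcases h_lam F hs ht hxs hx2.1 with h | h
      · exact hlt.2 (Finset.inter_subset_inter_right h)
      · exact hn t ht h (hBt.trans Finset.inter_subset_left)
    exact h1.c2 _ hh B hB B' hB' (aux B hBA ⟨⟨x, hxs, hxB⟩, hn⟩)
      (aux B' hBA' ⟨⟨x', hxs', hxB'⟩, hn'⟩)
  · intro z
    rw [h1.c3]
    refine and_congr_right fun hne => ?_
    obtain ⟨x, hx⟩ := hne
    constructor
    · rintro ⟨h, hh, B, hB, rfl⟩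
      obtain ⟨hxh, hxB⟩ := Finset.mem_inter.mp hx
      obtain ⟨-, s, hs, A, hA, rfl⟩ := (h2.c3 _).mp hh
      obtain ⟨A', hA', hBA'⟩ := hup B hB
      have e := h_comp_eq H hA hA' (Finset.mem_inter.mp hxh).2 (hBA' hxB)
      subst e
      refine ⟨s, hs, B, hB, ?_⟩
      rw [Finset.inter_assoc, Finset.inter_eq_right.mpr hBA']
    · rintro ⟨s, hs, B, hB, rfl⟩
      obtain ⟨hxs, hxB⟩ := Finset.mem_inter.mp hx
      obtain ⟨A, hA, hBA⟩ := hup B hB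
      refine ⟨s ∩ A, (h2.c3 _).mpr ⟨⟨x, Finset.mem_inter.mpr ⟨hxs, hBA hxB⟩⟩, s, hs, A, hA, rfl⟩,
        B, hB, ?_⟩
      rw [Finset.inter_assoc, Finset.inter_eq_right.mpr hBA]

theorem HSubf.factor {G H F : XForest X} (h1 : HSubf G F) (h2 : HSubf H F)
    (h : ∀ B ∈ G.components, ∃ s ∈ H.clusters, B ⊆ s) : HSubf G H := by
  have hup : ∀ B ∈ G.components, ∃ A ∈ H.components, B ⊆ A := by
    intro B hB
    obtain ⟨s, hs, hBs⟩ := h B hB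
    obtain ⟨A, hA, hsA⟩ := h_exists_comp H hs
    exact ⟨A, hA, hBs.trans hsA⟩
  refine ⟨h, ?_, ?_⟩
  · intro u hu B hB B' hB' hU hU'
    obtain ⟨-, s0, hs0, A, hA, hus0⟩ := (h2.c3 _).mp hu
    have hmem : s0 ∈ F.clusters.filter fun s => s ∩ A = u :=
      Finset.mem_filter.mpr ⟨hs0, hus0.symm⟩
    obtain ⟨s, -, hsm⟩ := Finset.exists_le_minimal _ hmem
    obtain ⟨hs, hus⟩ := Finset.mem_filter.mp hsm.1
    have aux : ∀ B ∈ G.components, HUsed H u B → HUsed F s B := by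
      rintro B hB ⟨⟨x, hxu, hxB⟩, hn⟩
      have hx := hxu
      rw [← hus, Finset.mem_inter] at hx
      obtain ⟨A', hA', hBA'⟩ := hup B hB
      have e := h_comp_eq H hA hA' hx.2 (hBA' hxB)
      subst e
      refine ⟨⟨x, hx.1, hxB⟩, fun t ht hts hBt => ?_⟩
      have hBtA : B ⊆ t ∩ A := Finset.subset_inter hBt hBA'
      have htA : t ∩ A ∈ H.clusters := (h2.c3 _).mpr ⟨⟨x, hBtA hxB⟩, t, ht, A, hA, rfl⟩
      have hle : t ∩ A ⊆ u := by
        rw [← hus]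
        exact Finset.inter_subset_inter_right hts.1
      refine hn _ htA (Finset.ssubset_iff_subset_ne.mpr ⟨hle, fun e => ?_⟩) hBtA
      exact hts.2 (hsm.2 (Finset.mem_filter.mpr ⟨ht, e⟩) hts.1)
    exact h1.c2 s hs B hB B' hB' (aux B hB hU) (aux B' hB' hU')
  · intro z
    rw [h1.c3]
    refine and_congr_right fun hne => ?_
    obtain ⟨x, hx⟩ := hne
    constructor
    · rintro ⟨s, hs, B, hB, rfl⟩
      obtain ⟨hxs, hxB⟩ := Finset.mem_inter.mp hx
      obtain ⟨A, hA, hBA⟩ := hup B hB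
      refine ⟨s ∩ A, (h2.c3 _).mpr ⟨⟨x, Finset.mem_inter.mpr ⟨hxs, hBA hxB⟩⟩, s, hs, A, hA, rfl⟩,
        B, hB, ?_⟩
      rw [Finset.inter_assoc, Finset.inter_eq_right.mpr hBA]
    · rintro ⟨h, hh, B, hB, rfl⟩
      obtain ⟨hxh, hxB⟩ := Finset.mem_inter.mp hx
      obtain ⟨-, s, hs, A, hA, rfl⟩ := (h2.c3 _).mp hh
      obtain ⟨A', hA', hBA'⟩ := hup B hB
      have e := h_comp_eq H hA hA' (Finset.mem_inter.mp hxh).2 (hBA' hxB)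
      subst e
      refine ⟨s, hs, B, hB, ?_⟩
      rw [Finset.inter_assoc, Finset.inter_eq_right.mpr hBA']

theorem h_cut_sub (F : XForest X) {c : Finset X} (hc : c ∈ F.clusters) :
    IsSubforest (F.cut {c}) F :=
  ⟨{c}, by simpa using hc, rfl⟩

theorem h_mem_cut1 (F : XForest X) {c : Finset X} (hc : c ∈ F.clusters) (z : Finset X) :
    z ∈ (F.cut {c}).clusters ↔ ∃ s ∈ F.clusters, (c ⊂ s ∧ z = s \ c) ∨ (¬ c ⊂ s ∧ z = s) := by
  rw [h_mem_cut]
  simp only [Finset.mem_singleton, forall_eq, hc, true_imp_iff]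
  constructor
  · rintro ⟨hne, s, hs, h⟩
    refine ⟨s, hs, ?_⟩
    by_cases hcs : c ⊂ s
    · refine Or.inl ⟨hcs, ?_⟩
      ext x
      rw [h x, Finset.mem_sdiff]
      exact and_congr_right fun _ => ⟨fun h => h hcs, fun h _ => h⟩
    · refine Or.inr ⟨hcs, ?_⟩
      ext x
      rw [h x]
      exact ⟨fun h => h.1, fun h => ⟨h, fun h' => absurd h' hcs⟩⟩
  · rintro ⟨s, hs, ⟨hcs, rfl⟩ | ⟨hcs, rfl⟩⟩
    · refine ⟨Finset.sdiff_nonempty.mpr hcs.2, s, hs, fun x => ?_⟩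
      rw [Finset.mem_sdiff]
      exact and_congr_right fun _ => ⟨fun h _ => h, fun h => h hcs⟩
    · refine ⟨F.nonempty_of_mem _ hs, z, hs, fun x => ?_⟩
      exact ⟨fun h => ⟨h, fun h' => absurd h' hcs⟩, fun h => h.1⟩

theorem h_unused {G F : XForest X} {c : Finset X} (hc : c ∈ F.clusters)
    (h : IsSubforest G F) (hu : ¬ F.EdgeUsed c G) : IsSubforest G (F.cut {c}) := by
  have h1 := HSubf.of_isSubforest h
  refine HSubf.isSubforest (h1.factor (HSubf.of_isSubforest (h_cut_sub F hc)) ?_)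
  intro B hB
  by_cases hx : ∃ x, x ∈ c ∧ x ∈ B
  · obtain ⟨x, hxc, hxB⟩ := hx
    refine ⟨c, (h_mem_cut1 F hc c).mpr ⟨c, hc, Or.inr ⟨fun h => h.2 (Finset.Subset.refl _), rfl⟩⟩, ?_⟩
    intro y hy
    by_contra hyc
    obtain ⟨s, hs, hBs⟩ := h1.c1 B hB
    obtain ⟨C, hC, hsC⟩ := h_exists_comp F hs
    exact hu ⟨x, hxc, y, hyc, ⟨C, hC, hsC (hBs hxB), hsC (hBs hy)⟩, B, hB, hxB, hy⟩
  · obtain ⟨s, hs, hBs⟩ := h1.c1 B hB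
    by_cases hcs : c ⊂ s
    · refine ⟨s \ c, (h_mem_cut1 F hc _).mpr ⟨s, hs, Or.inl ⟨hcs, rfl⟩⟩, fun y hy => ?_⟩
      exact Finset.mem_sdiff.mpr ⟨hBs hy, fun hyc => hx ⟨y, hyc, hy⟩⟩
    · exact ⟨s, (h_mem_cut1 F hc _).mpr ⟨s, hs, Or.inr ⟨hcs, rfl⟩⟩, hBs⟩

theorem h_ord_cut (F : XForest X) {c v : Finset X} (h : F.IsChild c v) :
    (F.cut {c}).ord = F.ord + 1 := by
  obtain ⟨hc, hv, hcv, -⟩ := h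
  obtain ⟨P, hP, hvP⟩ := h_exists_comp F hv
  have hcP : c ⊂ P := lt_of_lt_of_le hcv hvP
  have hPc := ((h_mem_comp F P).mp hP).1
  obtain ⟨w, hw⟩ := F.nonempty_of_mem c hc
  obtain ⟨z, hz⟩ := Finset.sdiff_nonempty.mpr hcP.2
  obtain ⟨hzP, hzc⟩ := Finset.mem_sdiff.mp hz
  have hcH : c ∈ (F.cut {c}).clusters :=
    (h_mem_cut1 F hc c).mpr ⟨c, hc, Or.inr ⟨fun h => h.2 (Finset.Subset.refl _), rfl⟩⟩
  have hPH : P \ c ∈ (F.cut {c}).clusters :=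
    (h_mem_cut1 F hc _).mpr ⟨P, hPc, Or.inl ⟨hcP, rfl⟩⟩
  have hcomp : (F.cut {c}).components = insert c (insert (P \ c) (F.components.erase P)) := by
    ext Q
    rw [Finset.mem_insert, Finset.mem_insert, Finset.mem_erase, h_mem_comp]
    constructor
    · rintro ⟨hQ, hmax⟩
      obtain ⟨s, hs, hsQ⟩ := (h_mem_cut1 F hc Q).mp hQ
      by_cases hsP : s ⊆ P
      · by_cases hsc : s ⊆ c
        · left
          rcases hsQ with ⟨h, -⟩ | ⟨-, rfl⟩
          · exact absurd hsc h.2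
          · exact (hmax c hcH hsc).symm
        · right; left
          refine (hmax _ hPH fun y hy => ?_).symm
          rcases hsQ with ⟨h, rfl⟩ | ⟨h, rfl⟩
          · exact Finset.sdiff_subset_sdiff hsP (Finset.Subset.refl _) hy
          · refine Finset.mem_sdiff.mpr ⟨hsP hy, fun hyc => ?_⟩
            rcases h_lam F hs hc hy hyc with h' | h'
            · exact hsc h'
            · exact h h'
      · right; right
        have hdis : ∀ t ∈ F.clusters, s ⊆ t → ∀ x, x ∈ t → x ∉ P := fun t ht hst x hx hxP =>
          hsP (hst.trans (h_sub_comp F ht hP hx hxP))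
        have hnot : ∀ t ∈ F.clusters, s ⊆ t → ¬ c ⊂ t := fun t ht hst hct =>
          hdis t ht hst w (hct.1 hw) (hcP.1 hw)
        rcases hsQ with ⟨h, -⟩ | ⟨-, rfl⟩
        · exact absurd h (hnot s hs (Finset.Subset.refl _))
        · refine ⟨fun e => hsP e.subset, (h_mem_comp F _).mpr ⟨hs, fun t ht hst => ?_⟩⟩
          exact hmax t ((h_mem_cut1 F hc t).mpr ⟨t, ht, Or.inr ⟨hnot t ht hst, rfl⟩⟩) hst
    · rintro (rfl | rfl | ⟨hQP, hQ⟩)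
      · refine ⟨hcH, fun t ht hst => ?_⟩
        obtain ⟨s, hs, ⟨h, rfl⟩ | ⟨h, rfl⟩⟩ := (h_mem_cut1 F hc t).mp ht
        · exact absurd hw (Finset.mem_sdiff.mp (hst hw)).2
        · by_contra hne
          exact h (Finset.ssubset_iff_subset_ne.mpr ⟨hst, fun e => hne e.symm⟩)
      · refine ⟨hPH, fun t ht hst => Finset.Subset.antisymm ?_ hst⟩
        obtain ⟨s, hs, ⟨h, rfl⟩ | ⟨h, rfl⟩⟩ := (h_mem_cut1 F hc t).mp ht
        · have := h_sub_comp F hs hP (Finset.mem_sdiff.mp (hst hz)).1 hzP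
          exact Finset.sdiff_subset_sdiff this (Finset.Subset.refl _)
        · have hsP := h_sub_comp F hs hP (hst hz) hzP
          intro y hy
          refine Finset.mem_sdiff.mpr ⟨hsP hy, fun hyc => ?_⟩
          rcases h_lam F hs hc hy hyc with h' | h'
          · exact hzc (h' (hst hz))
          · exact h h'
      · obtain ⟨hQc, hQm⟩ := (h_mem_comp F Q).mp hQ
        have hnQ : ¬ c ⊂ Q := fun h => hQP (h_comp_eq F hQ hP (h.1 hw) (hcP.1 hw))
        refine ⟨(h_mem_cut1 F hc Q).mpr ⟨Q, hQc, Or.inr ⟨hnQ, rfl⟩⟩, fun t ht hst => ?_⟩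
        obtain ⟨s, hs, ⟨h, rfl⟩ | ⟨h, rfl⟩⟩ := (h_mem_cut1 F hc t).mp ht
        · have e := hQm s hs (hst.trans Finset.sdiff_subset)
          rw [e] at h
          exact absurd h hnQ
        · exact hQm _ hs hst
  unfold ord
  rw [hcomp, Finset.card_insert_of_notMem, Finset.card_insert_of_notMem,
    Finset.card_erase_of_mem hP]
  · have := Finset.card_pos.mpr ⟨P, hP⟩
    omega
  · intro hm
    obtain ⟨hne, hm⟩ := Finset.mem_erase.mp hm
    exact hne (h_comp_eq F hm hP hz hzP)
  · intro hm
    rcases Finset.mem_insert.mp hm with e | hm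
    · rw [e] at hw
      exact (Finset.mem_sdiff.mp hw).2 (e ▸ hw)
    · obtain ⟨hne, hm⟩ := Finset.mem_erase.mp hm
      exact hne (h_comp_eq F hm hP hw (hcP.1 hw))

theorem h_not_both {Fi Fj G : XForest X} {C v c₁ c₂ : Finset X}
    (hi : IsSubforest G Fi) (hj : IsSubforest G Fj) (hC : C ∈ Fi.components)
    (hc₁ : Fj.IsChild c₁ v) (hc₂ : Fj.IsChild c₂ v)
    (hsub : c₁ ⊆ C) (hdisj : c₂ ∩ C = ∅) : ¬ (Fj.EdgeUsed c₁ G ∧ Fj.EdgeUsed c₂ G) := by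
  rintro ⟨⟨x, hx, y, hy, -, B, hB, hxB, hyB⟩, ⟨x', hx', y', hy', -, B', hB', hxB', hyB'⟩⟩
  have hi := HSubf.of_isSubforest hi
  have hj := HSubf.of_isSubforest hj
  -- both components use the vertex v
  have used : ∀ c, Fj.IsChild c v → ∀ B ∈ G.components, ∀ x y, x ∈ c → y ∉ c → x ∈ B → y ∈ B →
      HUsed Fj v B := by
    rintro c ⟨hc, hv, hcv, hbt⟩ B hB x y hx hy hxB hyB
    refine ⟨⟨x, hcv.1 hx, hxB⟩, fun t ht htv hBt => ?_⟩
    rcases h_lam Fj ht hc (hBt hxB) hx with h | h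
    · exact hy (h (hBt hyB))
    · exact hbt t ht h htv
  have e : B = B' := hj.c2 v hc₁.2.1 B hB B' hB' (used c₁ hc₁ B hB x y hx hy hxB hyB)
    (used c₂ hc₂ B' hB' x' y' hx' hy' hxB' hyB')
  subst e
  obtain ⟨s, hs, hBs⟩ := hi.c1 B hB
  have hxC : x' ∈ C := h_sub_comp Fi hs hC (hBs hxB) (hsub hx) (hBs hxB')
  have : x' ∈ c₂ ∩ C := Finset.mem_inter.mpr ⟨hx', hxC⟩
  rw [hdisj] at this
  exact absurd this (Finset.notMem_empty _)

theorem h_bound {m : ℕ} (I : Inst X m) (j : Fin m) (H : XForest X)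
    (hH : H.ord = (I.F j).ord + 1) :
    ((Inst.mk (Function.update I.F j H) (cutk I j)).ordMax : ℤ) + cutk I j =
      (I.ordMax : ℤ) + I.k := by
  have hle : ∀ i, (I.F i).ord ≤ I.ordMax := fun i =>
    Finset.le_sup (f := fun i => (I.F i).ord) (Finset.mem_univ i)
  have hle' : H.ord ≤ (Inst.mk (Function.update I.F j H) (cutk I j)).ordMax := by
    have := Finset.le_sup (f := fun i => (Function.update I.F j H i).ord) (Finset.mem_univ j)
    simpa [Inst.ordMax] using this
  have hge : I.ordMax ≤ (Inst.mk (Function.update I.F j H) (cutk I j)).ordMax := by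
    refine Finset.sup_mono_fun fun i _ => ?_
    by_cases e : i = j
    · subst e
      simp [hH]
    · simp [e]
  have hup : (Inst.mk (Function.update I.F j H) (cutk I j)).ordMax ≤ max I.ordMax H.ord := by
    refine Finset.sup_le fun i _ => ?_
    by_cases e : i = j
    · subst e
      simp
    · have := hle i
      simp [e, this]
  have hj := hle j
  generalize (Inst.mk (Function.update I.F j H) (cutk I j)).ordMax = M at *
  unfold cutk
  split_ifs with h <;> omega

theorem h_branch {m : ℕ} (I : Inst X m) (j : Fin m) {c v : Finset X} (h : (I.F j).IsChild c v)
    (G : XForest X) :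
    (Inst.mk (Function.update I.F j ((I.F j).cut {c})) (cutk I j)).IsSolution G ↔
      I.IsSolution G ∧ IsSubforest G ((I.F j).cut {c}) := by
  unfold Inst.IsSolution
  simp only [h_bound I j _ (h_ord_cut _ h)]
  constructor
  · rintro ⟨h1, h2⟩
    have hj : IsSubforest G ((I.F j).cut {c}) := by simpa using h1 j
    refine ⟨⟨fun i => ?_, h2⟩, hj⟩
    by_cases e : i = j
    · subst e
      exact ((HSubf.of_isSubforest hj).trans
        (HSubf.of_isSubforest (h_cut_sub _ h.1))).isSubforest
    · simpa [e] using h1 i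
  · rintro ⟨⟨h1, h2⟩, hj⟩
    refine ⟨fun i => ?_, h2⟩
    by_cases e : i = j
    · subst e
      simpa using hj
    · simpa [e] using h1 i

end helpers

end XForest

/-- Lemma 3.2.  Branching Rule 1 is safe: in the situation of
Case 1, every hard agreement forest for `{F_1, …, F_m}` omits at least one of
the edges `[v,c₁]` and `[v,c₂]` of `F_j`; consequently the instance is a
yes-instance iff at least one of the two produced instances is. -/
theorem statement_1 {X : Type*} [DecidableEq X] [Fintype X] {m : ℕ}
    (I I₁ I₂ : Inst X m) (i j : Fin m) (hij : i ≠ j)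
    (C v c₁ c₂ : Finset X) (hC : C ∈ (I.F i).components)
    (hc₁ : (I.F j).IsChild c₁ v) (hc₂ : (I.F j).IsChild c₂ v) (hne : c₁ ≠ c₂)
    (hsub : c₁ ⊆ C) (hdisj : c₂ ∩ C = ∅)
    (hI₁ : I₁ = ⟨Function.update I.F j ((I.F j).cut {c₁}), cutk I j⟩)
    (hI₂ : I₂ = ⟨Function.update I.F j ((I.F j).cut {c₂}), cutk I j⟩) :
    (∀ G : XForest X, IsHAF I.F G →
      ¬((I.F j).EdgeUsed c₁ G ∧ (I.F j).EdgeUsed c₂ G)) ∧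
    (I.IsYes ↔ I₁.IsYes ∨ I₂.IsYes) := by
  have hA : ∀ G : XForest X, IsHAF I.F G →
      ¬((I.F j).EdgeUsed c₁ G ∧ (I.F j).EdgeUsed c₂ G) := fun G hG =>
    XForest.h_not_both (hG i) (hG j) hC hc₁ hc₂ hsub hdisj
  refine ⟨hA, ?_⟩
  subst hI₁ hI₂
  constructor
  · rintro ⟨G, hG⟩
    by_cases hu : (I.F j).EdgeUsed c₁ G
    · have hu2 : ¬ (I.F j).EdgeUsed c₂ G := fun h => hA G hG.1 ⟨hu, h⟩
      exact Or.inr ⟨G, (XForest.h_branch I j hc₂ G).mpr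
        ⟨hG, XForest.h_unused hc₂.1 (hG.1 j) hu2⟩⟩
    · exact Or.inl ⟨G, (XForest.h_branch I j hc₁ G).mpr
        ⟨hG, XForest.h_unused hc₁.1 (hG.1 j) hu⟩⟩
  · rintro (⟨G, hG⟩ | ⟨G, hG⟩)
    · exact ⟨G, ((XForest.h_branch I j hc₁ G).mp hG).1⟩
    · exact ⟨G, ((XForest.h_branch I j hc₂ G).mp hG).1⟩
end

section
/- Any instance (F_1,…,F_m;k) of the hMaf problem on which neither Reduction Rule 1 nor Branching Rule 1 is applicable satisfies the label-set isomorphism property, i.e., for every pair of X-forests F_i, F_j in the instance and every connected component C of F_i there is a connected component C' of F_j with L(C) = L(C'). -/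
/-!
A formalization framework for the Maximum Agreement Forest problem on multiple
rooted multifurcating phylogenetic trees.

An `X`-forest is modeled (up to forced contraction and label-preserving
isomorphism) by the laminar family of the label-sets `L(v)` of its vertices:
every vertex `v` is identified with the set `L(v)` of labels at its leaf
descendants, components correspond to the maximal clusters, leaves to the
singleton clusters, and the edge between a non-root vertex `v` and its parent
is identified with the cluster `L(v)`.
-/

open Finset

theorem exists_component_of_mem {X : Type*} [DecidableEq X] [Fintype X] (F : XForest X)
    (s : Finset X) (hs : s ∈ F.clusters) : ∃ C ∈ F.components, s ⊆ C := by
  obtain ⟨C, hsC, hC⟩ := F.clusters.exists_le_maximal hs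
  refine ⟨C, Finset.mem_filter.mpr ⟨hC.1, fun t ht hlt => ?_⟩, hsC⟩
  exact hlt.2 (hC.2 ht hlt.1)

theorem component_eq {X : Type*} [DecidableEq X] [Fintype X] (F : XForest X)
    (C D : Finset X) (hC : C ∈ F.components) (hD : D ∈ F.components)
    (z : X) (hzC : z ∈ C) (hzD : z ∈ D) : C = D := by
  obtain ⟨hC1, hC2⟩ := Finset.mem_filter.mp hC
  obtain ⟨hD1, hD2⟩ := Finset.mem_filter.mp hD
  rcases F.laminar C hC1 D hD1 (Finset.not_disjoint_iff.mpr ⟨z, hzC, hzD⟩) with h | h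
  · by_contra hne
    exact hC2 D hD1 (Finset.ssubset_iff_subset_ne.mpr ⟨h, hne⟩)
  · by_contra hne
    exact hD2 C hC1 (Finset.ssubset_iff_subset_ne.mpr ⟨h, fun e => hne e.symm⟩)

theorem exists_child {X : Type*} [DecidableEq X] [Fintype X] (F : XForest X)
    (v : Finset X) (hv : v ∈ F.clusters) (x : X) (hx : x ∈ v) (hne : v ≠ {x}) :
    ∃ c, F.IsChild c v ∧ x ∈ c := by
  classical
  have h0 : ({x} : Finset X) ∈ F.clusters.filter (fun c => c ⊂ v) := by
    refine Finset.mem_filter.mpr ⟨F.singleton_mem x, Finset.ssubset_iff_subset_ne.mpr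
      ⟨Finset.singleton_subset_iff.mpr hx, fun e => hne e.symm⟩⟩
  obtain ⟨c, hxc, hc⟩ := (F.clusters.filter (fun c => c ⊂ v)).exists_le_maximal h0
  obtain ⟨hc1, hc2⟩ := Finset.mem_filter.mp hc.1
  refine ⟨c, ⟨hc1, hv, hc2, fun t ht hct htv => ?_⟩, Finset.singleton_subset_iff.mp hxc⟩
  exact hct.2 (hc.2 (Finset.mem_filter.mpr ⟨ht, htv⟩) hct.1)

/-- If Branching Rule 1 is not applicable on `G` relative to `F`, then every cluster of `G`
is contained in a component of `F`. -/
theorem cluster_sub_component {X : Type*} [DecidableEq X] [Fintype X] (F G : XForest X)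
    (hbr : ∀ v c₁ c₂ : Finset X, ¬BR1AppCore F G v c₁ c₂) (v : Finset X) :
    v ∈ G.clusters → ∃ C ∈ F.components, v ⊆ C := by
  induction v using Finset.strongInduction with
  | H v ih =>
    intro hv
    by_contra hno
    push Not at hno
    have hns : ∀ x, v ≠ {x} := by
      rintro x rfl
      obtain ⟨C, hC, h⟩ := exists_component_of_mem F {x} (F.singleton_mem x)
      exact hno C hC h
    obtain ⟨x, hx⟩ := G.nonempty_of_mem v hv
    obtain ⟨c₁, hc₁, hx₁⟩ := exists_child G v hv x hx (hns x)
    obtain ⟨C, hC, h₁⟩ := ih c₁ hc₁.2.2.1 hc₁.1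
    obtain ⟨y, hy, hyC⟩ := Finset.not_subset.mp (hno C hC)
    obtain ⟨c₂, hc₂, hy₂⟩ := exists_child G v hv y hy (hns y)
    obtain ⟨D, hD, h₂⟩ := ih c₂ hc₂.2.2.1 hc₂.1
    refine hbr v c₁ c₂ ⟨C, hC, hc₁, hc₂, ?_, h₁, ?_⟩
    · rintro rfl
      exact hyC (h₁ hy₂)
    · rw [Finset.eq_empty_iff_forall_notMem]
      intro z hz
      obtain ⟨hz2, hzC⟩ := Finset.mem_inter.mp hz
      have e := component_eq F C D hC hD z hzC (h₂ hz2)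
      exact hyC (e ▸ h₂ hy₂)

/-- Lemma 3.3.  Any instance of the hMaf problem on which
neither Reduction Rule 1 nor Branching Rule 1 is applicable satisfies the
label-set isomorphism property: for every pair of forests `F_i, F_j` and every
connected component `C` of `F_i` there is a connected component `C'` of `F_j`
with `L(C) = L(C')`. -/
theorem statement_2 {X : Type*} [DecidableEq X] [Fintype X] {m : ℕ}
    (I : Inst X m)
    (hrr : ∀ i j : Fin m, i ≠ j → ∀ v : Finset X, ¬RR1App (I.F i) (I.F j) v)
    (hbr : ∀ i j : Fin m, i ≠ j →
      ∀ v c₁ c₂ : Finset X, ¬BR1AppCore (I.F i) (I.F j) v c₁ c₂) :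
    ∀ i j : Fin m, ∀ C ∈ (I.F i).components, ∃ C' ∈ (I.F j).components, C = C' := by
  intro i j C hC
  by_cases hij : i = j
  · subst hij
    exact ⟨C, hC, rfl⟩
  obtain ⟨C', hC', hsub⟩ :=
    cluster_sub_component (I.F j) (I.F i) (hbr j i (Ne.symm hij)) C
      (Finset.mem_filter.mp hC).1
  obtain ⟨D, hD, hsub2⟩ :=
    cluster_sub_component (I.F i) (I.F j) (hbr i j hij) C'
      (Finset.mem_filter.mp hC').1
  refine ⟨C', hC', Finset.Subset.antisymm hsub ?_⟩
  by_contra hn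
  exact (Finset.mem_filter.mp hC).2 D (Finset.mem_filter.mp hD).1
    ⟨hsub.trans hsub2, fun h => hn (hsub2.trans h)⟩
end

section
/- Let (F_1,…,F_m;k) be an instance of the hMaf problem on which Reduction Rule 1 is not applicable, let (F_1^*,…,F_m^*;k^*) be any instance obtained by the 2-BR-process on F_p and F_q (p < q), and let S_B be the set of edges removed by Branching Rule 1 during this 2-BR-process. Then Ord(F_p^*) = Ord(F_q^*) ≥ |S_B| + max{Ord(F_p), Ord(F_q)}. -/
/-!
A formalization framework for the Maximum Agreement Forest problem on multiple
rooted multifurcating phylogenetic trees.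

An `X`-forest is modeled (up to forced contraction and label-preserving
isomorphism) by the laminar family of the label-sets `L(v)` of its vertices:
every vertex `v` is identified with the set `L(v)` of labels at its leaf
descendants, components correspond to the maximal clusters, leaves to the
singleton clusters, and the edge between a non-root vertex `v` and its parent
is identified with the cluster `L(v)`.
-/

open Finset

section Proof

open scoped Classical

variable {X : Type*} [DecidableEq X] [Fintype X] {m : ℕ}

/-- The relation of lying in a common component (equivalently, a common cluster). -/
def sameComp (F : XForest X) : Setoid X where
  r x y := ∃ c ∈ F.clusters, x ∈ c ∧ y ∈ c
  iseqv := by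
    refine ⟨fun x => ⟨{x}, F.singleton_mem x, by simp, by simp⟩, ?_, ?_⟩
    · rintro x y ⟨c, hc, hx, hy⟩
      exact ⟨c, hc, hy, hx⟩
    · rintro x y z ⟨c, hc, hx, hy⟩ ⟨d, hd, hy', hz⟩
      rcases F.laminar c hc d hd (Finset.not_disjoint_iff.mpr ⟨y, hy, hy'⟩) with h | h
      · exact ⟨d, hd, h hx, hz⟩
      · exact ⟨c, hc, hx, h hz⟩

theorem sameComp_iff (F : XForest X) (x y : X) :
    sameComp F x y ↔ ∃ c ∈ F.clusters, x ∈ c ∧ y ∈ c := Iff.rfl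

theorem exists_comp (F : XForest X) (c : Finset X) (hc : c ∈ F.clusters) :
    ∃ C ∈ F.components, c ⊆ C := by
  obtain ⟨C, hcC, hC⟩ := F.clusters.exists_le_maximal hc
  refine ⟨C, Finset.mem_filter.mpr ⟨hC.1, fun t ht hlt => ?_⟩, hcC⟩
  exact hlt.2 (hC.2 ht hlt.1)

theorem comp_mem (F : XForest X) {C : Finset X} (hC : C ∈ F.components) : C ∈ F.clusters :=
  (Finset.mem_filter.mp hC).1

theorem comp_unique (F : XForest X) {C D : Finset X} (hC : C ∈ F.components)
    (hD : D ∈ F.components) {x : X} (hx : x ∈ C) (hx' : x ∈ D) : C = D := by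
  have h1 := Finset.mem_filter.mp hC
  have h2 := Finset.mem_filter.mp hD
  by_contra hne
  rcases F.laminar C h1.1 D h2.1 (Finset.not_disjoint_iff.mpr ⟨x, hx, hx'⟩) with h | h
  · exact h1.2 D h2.1 (Finset.ssubset_iff_subset_ne.mpr ⟨h, hne⟩)
  · exact h2.2 C h1.1 (Finset.ssubset_iff_subset_ne.mpr ⟨h, Ne.symm hne⟩)

theorem sameComp_iff_comp (F : XForest X) (x y : X) :
    sameComp F x y ↔ ∃ C ∈ F.components, x ∈ C ∧ y ∈ C := by
  constructor
  · rintro ⟨c, hc, hx, hy⟩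
    obtain ⟨C, hC, h⟩ := exists_comp F c hc
    exact ⟨C, hC, h hx, h hy⟩
  · rintro ⟨C, hC, hx, hy⟩
    exact ⟨C, comp_mem F hC, hx, hy⟩

theorem ord_eq (F : XForest X) : F.ord = Nat.card (Quotient (sameComp F)) := by
  have hex : ∀ x : X, ∃ C : {C // C ∈ F.components}, x ∈ C.1 := by
    intro x
    obtain ⟨C, hC, h⟩ := exists_comp F {x} (F.singleton_mem x)
    exact ⟨⟨C, hC⟩, h (by simp)⟩
  choose f hf using hex
  have hsurj : Function.Surjective f := by
    rintro ⟨C, hC⟩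
    obtain ⟨x, hx⟩ := F.nonempty_of_mem C (comp_mem F hC)
    exact ⟨x, Subtype.ext (comp_unique F (f x).2 hC (hf x) hx)⟩
  have hker : Setoid.ker f = sameComp F := by
    ext x y
    rw [sameComp_iff_comp]
    constructor
    · intro h
      have h' : f x = f y := h
      exact ⟨(f x).1, (f x).2, hf x, h' ▸ hf y⟩
    · rintro ⟨C, hC, hx, hy⟩
      show f x = f y
      apply Subtype.ext
      rw [comp_unique F (f x).2 hC (hf x) hx, comp_unique F (f y).2 hC (hf y) hy]
  rw [← hker, Nat.card_congr (Setoid.quotientKerEquivOfSurjective f hsurj)]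
  simp [XForest.ord]

theorem card_quot_le {r s : Setoid X} (h : r ≤ s) :
    Nat.card (Quotient s) ≤ Nat.card (Quotient r) := by
  apply Nat.card_le_card_of_surjective (Quotient.map' (s₁ := r) (s₂ := s) id (fun _ _ hab => h hab))
  rintro ⟨x⟩
  exact ⟨Quotient.mk r x, rfl⟩

theorem card_quot_lt {r s : Setoid X} (h : r ≤ s) {x y : X} (hs : s x y) (hr : ¬ r x y) :
    Nat.card (Quotient s) < Nat.card (Quotient r) := by
  refine lt_of_le_of_ne (card_quot_le h) fun he => hr ?_
  have hsurj : Function.Surjective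
      (Quotient.map' (s₁ := r) (s₂ := s) id (fun _ _ hab => h hab)) := by
    rintro ⟨x⟩
    exact ⟨Quotient.mk r x, rfl⟩
  have hb := (Nat.bijective_iff_surjective_and_card _).mpr ⟨hsurj, he.symm⟩
  have : Quotient.mk r x = Quotient.mk r y := hb.1 (Quotient.sound hs)
  exact Quotient.exact this

theorem cut_le (F : XForest X) (D : Finset (Finset X)) :
    sameComp (F.cut D) ≤ sameComp F := by
  rintro x y ⟨c, hc, hx, hy⟩
  obtain ⟨s, hs, rfl⟩ := Finset.mem_image.mp (Finset.mem_filter.mp hc).1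
  exact ⟨s, hs, (Finset.mem_sdiff.mp hx).1, (Finset.mem_sdiff.mp hy).1⟩

theorem cut_sep (F : XForest X) (c : Finset X) (hc : c ∈ F.clusters) {x y : X}
    (hx : x ∈ c) (hy : y ∉ c) : ¬ sameComp (F.cut {c}) x y := by
  rintro ⟨s', hs', hxs, hys⟩
  obtain ⟨s, hs, rfl⟩ := Finset.mem_image.mp (Finset.mem_filter.mp hs').1
  rw [Finset.mem_sdiff] at hxs hys
  rcases F.laminar c hc s hs (Finset.not_disjoint_iff.mpr ⟨x, hx, hxs.1⟩) with h | h
  · refine hxs.2 (Finset.mem_biUnion.mpr ⟨c, ?_, hx⟩)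
    refine Finset.mem_filter.mpr ⟨Finset.mem_filter.mpr ⟨by simp, hc⟩, h, fun h' => hy (h' hys.1)⟩
  · exact hy (h hys.1)

/-- If Reduction Rule 1 does not apply at a non-root vertex, then the edge above it
separates two labels lying in a common component of both forests. -/
theorem exists_sep (Fi Fj : XForest X) (c v : Finset X) (h : Fj.IsChild c v)
    (hrr : ¬ RR1App Fi Fj c) :
    ∃ x ∈ c, ∃ y, y ∉ c ∧ sameComp Fi x y ∧ sameComp Fj x y := by
  by_contra hno
  push Not at hno
  apply hrr
  obtain ⟨hc, hv, hcv, -⟩ := h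
  obtain ⟨C, hC, hcC⟩ := exists_comp Fj c hc
  refine ⟨Fi.components.filter fun D => ∃ x ∈ c, x ∈ D, Finset.filter_subset _ _, ?_,
    C, hC, hc, hcC, ⟨v, hv, hcv⟩, ?_⟩
  · obtain ⟨x, hx⟩ := Fj.nonempty_of_mem c hc
    obtain ⟨D, hD, h⟩ := exists_comp Fi {x} (Fi.singleton_mem x)
    exact ⟨D, Finset.mem_filter.mpr ⟨hD, x, hx, h (by simp)⟩⟩
  · ext y
    rw [Finset.mem_inter, Finset.mem_biUnion]
    constructor
    · intro hy
      obtain ⟨D, hD, h⟩ := exists_comp Fi {y} (Fi.singleton_mem y)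
      exact ⟨hcC hy, D, Finset.mem_filter.mpr ⟨hD, y, hy, h (by simp)⟩, h (by simp)⟩
    · rintro ⟨hyC, D, hD, hyD⟩
      obtain ⟨hD, x, hx, hxD⟩ := Finset.mem_filter.mp hD
      by_contra hy
      exact hno x hx y hy ⟨D, comp_mem Fi hD, hxD, hyD⟩ ⟨C, comp_mem Fj hC, hcC hx, hyC⟩

/-- Number of classes of the common refinement of two component partitions. -/
noncomputable def meetCard (F G : XForest X) : ℕ :=
  Nat.card (Quotient (sameComp F ⊓ sameComp G))

theorem meetCard_comm (F G : XForest X) : meetCard F G = meetCard G F := by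
  unfold meetCard
  rw [inf_comm]

theorem update_le (I : Inst X m) (j : Fin m) (D : Finset (Finset X)) (k : Fin m) :
    sameComp (Function.update I.F j ((I.F j).cut D) k) ≤ sameComp (I.F k) := by
  by_cases h : k = j
  · subst h
    rw [Function.update_self]
    exact cut_le _ _
  · rw [Function.update_of_ne h]

theorem rr_le {I J : Inst X m} (h : Relation.ReflTransGen RR1Step I J) (k : Fin m) :
    sameComp (J.F k) ≤ sameComp (I.F k) := by
  induction h with
  | refl => exact le_refl _
  | tail _ hstep ih =>
    obtain ⟨i, j, -, v, -, rfl⟩ := hstep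
    exact (update_le _ j {v} k).trans ih

theorem meetCard_mono {F G F' G' : XForest X} (h : sameComp F' ≤ sameComp F)
    (h' : sameComp G' ≤ sameComp G) : meetCard F G ≤ meetCard F' G' :=
  card_quot_le (inf_le_inf h h')

theorem meetCard_cut_lt (I : Inst X m) (hrr : ¬ RR1Applicable I) {i j : Fin m} (hij : i ≠ j)
    {c v : Finset X} (h : (I.F j).IsChild c v) :
    meetCard (I.F i) (I.F j) < meetCard (I.F i) ((I.F j).cut {c}) := by
  obtain ⟨x, hx, y, hy, hi, hj⟩ := exists_sep (I.F i) (I.F j) c v h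
    (fun h' => hrr ⟨i, j, hij, c, h'⟩)
  refine card_quot_lt (x := x) (y := y) (inf_le_inf le_rfl (cut_le _ _)) ⟨hi, hj⟩ ?_
  intro hh
  exact cut_sep (I.F j) c h.1 hx hy hh.2

theorem path_bound {p q : Fin m} {I I' : Inst X m} {n : ℕ} (hpath : TwoBRPath p q I I' n)
    (hrr : ¬ RR1Applicable I) :
    LabelIso (I'.F p) (I'.F q) ∧
      n + meetCard (I.F p) (I.F q) ≤ meetCard (I'.F p) (I'.F q) := by
  induction hpath with
  | done I h => exact ⟨h, by simp⟩
  | @step I I₁ I₂ J K I' n i j v c₁ c₂ hij hbr hpick hex hrest ih =>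
    obtain ⟨hne, ⟨C, hC, h1, h2, -⟩, rfl, rfl⟩ := hbr
    obtain ⟨ih1, ih2⟩ := ih hex.2
    refine ⟨ih1, ?_⟩
    have hJ : meetCard (I.F i) (I.F j) < meetCard (J.F i) (J.F j) := by
      rcases hpick with rfl | rfl
      · simpa [Function.update_of_ne hne] using meetCard_cut_lt I hrr hne h1
      · simpa [Function.update_of_ne hne] using meetCard_cut_lt I hrr hne h2
    have hJ' : meetCard (I.F p) (I.F q) < meetCard (J.F p) (J.F q) := by
      rcases hij with ⟨rfl, rfl⟩ | ⟨rfl, rfl⟩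
      · exact hJ
      · rwa [meetCard_comm (I.F j), meetCard_comm (J.F j)]
    have hK := meetCard_mono (rr_le hex.1 p) (rr_le hex.1 q)
    omega

end Proof

/-- Lemma 3.4.  For an instance on which Reduction Rule 1 is
not applicable and any instance `(F_1^*, …, F_m^*; k^*)` obtained by the
2-BR-process on `F_p` and `F_q` (`p < q`), along which `|S_B|` edges are
removed by Branching Rule 1, one has
`Ord(F_p^*) = Ord(F_q^*) ≥ |S_B| + max{Ord(F_p), Ord(F_q)}`. -/
theorem statement_3 {X : Type*} [DecidableEq X] [Fintype X] {m : ℕ}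
    (I I' : Inst X m) (p q : Fin m) (hpq : p < q) (n : ℕ)
    (hrr : ¬RR1Applicable I)
    (hpath : TwoBRPath p q I I' n) :
    (I'.F p).ord = (I'.F q).ord ∧
    n + max (I.F p).ord (I.F q).ord ≤ (I'.F p).ord := by
  obtain ⟨hiso, hb⟩ := path_bound hpath hrr
  have hiso' : (I'.F p).components = (I'.F q).components := hiso
  have hs : sameComp (I'.F p) = sameComp (I'.F q) := by
    ext x y
    rw [sameComp_iff_comp, sameComp_iff_comp, hiso']
  refine ⟨by simp only [XForest.ord, hiso'], ?_⟩
  have h1 : meetCard (I'.F p) (I'.F q) = (I'.F p).ord := by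
    rw [ord_eq, meetCard, ← hs, inf_idem]
  have h2 : (I.F p).ord ≤ meetCard (I.F p) (I.F q) := by
    rw [ord_eq]
    exact card_quot_le inf_le_left
  have h3 : (I.F q).ord ≤ meetCard (I.F p) (I.F q) := by
    rw [ord_eq]
    exact card_quot_le inf_le_right
  have := max_le h2 h3
  omega
end
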